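/- arXiv:2310.19101 — 2 statements merged into one kernel-verified Lean document; each statement's English description precedes it below -/
import Mathlib

section
/- Let d ≥ 3, let Ω = B_r(y₀) be an open ball in ℝ^d, and let V be Hölder continuous on closure(Ω) (there exist C > 0 and α ∈ (0,1] with |V(x) − V(x')| ≤ C|x − x'|^α for x, x' ∈ closure(Ω)). Let λ ∈ ℝ. Then the equation −Δu + V u = λu has a classical positive solution in closure(Ω) — a function u continuous on closure(Ω), twice continuously differentiable on Ω, satisfying the equation at every point of Ω and with u(x) > 0 for every x ∈ closure(Ω) — if and only if λ < λ₀(Ω; V). -/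
open MeasureTheory Metric Filter

/-- The Laplacian of a function on `ℝ^d`, as the sum of second partial derivatives. -/
noncomputable def laplacian {d : ℕ} (v : EuclideanSpace ℝ (Fin d) → ℝ)
    (x : EuclideanSpace ℝ (Fin d)) : ℝ :=
  ∑ i : Fin d, fderiv ℝ (fderiv ℝ v) x (EuclideanSpace.single i 1) (EuclideanSpace.single i 1)

/-- `λ₀(Ω; V)`: the infimum of the Rayleigh quotients
`(∫_Ω (|∇u|² + V u²)) / ∫_Ω u²` over nonzero `u ∈ C₀^∞(Ω)`. -/
noncomputable def lambda0 {d : ℕ} (Ω : Set (EuclideanSpace ℝ (Fin d)))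
    (V : EuclideanSpace ℝ (Fin d) → ℝ) : ℝ :=
  sInf {q : ℝ | ∃ u : EuclideanSpace ℝ (Fin d) → ℝ, ContDiff ℝ (⊤ : ℕ∞) u ∧
    HasCompactSupport u ∧ tsupport u ⊆ Ω ∧ u ≠ 0 ∧
    q = (∫ x in Ω, (‖gradient u x‖ ^ 2 + V x * (u x) ^ 2)) / ∫ x in Ω, (u x) ^ 2}

section Part1

open MeasureTheory Metric Filter

/-- Euclidean space of dimension `d`. -/
abbrev Euc (d : ℕ) := EuclideanSpace ℝ (Fin d)

/-- The `i`-th standard basis vector. -/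
noncomputable abbrev eb {d : ℕ} (i : Fin d) : Euc d := EuclideanSpace.single i 1

lemma norm_sq_dual {d : ℕ} (L : Euc d →L[ℝ] ℝ) : ‖L‖ ^ 2 = ∑ i, (L (eb i)) ^ 2 := by
  have h := (InnerProductSpace.toDual ℝ (Euc d)).symm.norm_map L
  rw [← h, EuclideanSpace.norm_sq_eq]
  refine Finset.sum_congr rfl fun i _ => ?_
  rw [Real.norm_eq_abs, sq_abs]
  congr 1
  have := InnerProductSpace.toDual_symm_apply (𝕜 := ℝ) (x := eb i) (y := L)
  rw [← this, eb, EuclideanSpace.inner_single_right]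
  simp

lemma norm_gradient {d : ℕ} (u : Euc d → ℝ) (x : Euc d) : ‖gradient u x‖ = ‖fderiv ℝ u x‖ := by
  rw [gradient]; exact LinearIsometryEquiv.norm_map _ _

lemma integral_fderiv_zero {d : ℕ} {X : Euc d → ℝ} (hX : ContDiff ℝ 1 X)
    (hc : HasCompactSupport X) (v : Euc d) : ∫ x, fderiv ℝ X x v = 0 := by
  have hcf : Continuous fun x => fderiv ℝ X x v := by
    have := hX.continuous_fderiv (by norm_num)
    fun_prop
  have hcs : HasCompactSupport fun x => fderiv ℝ X x v := hc.fderiv_apply (𝕜 := ℝ) v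
  have := integral_mul_fderiv_eq_neg_fderiv_mul_of_integrable (μ := volume) (𝕜 := ℝ)
    (f := fun _ : Euc d => (1 : ℝ)) (g := X) (v := v) (by simp)
    (by simpa using hcf.integrable_of_hasCompactSupport hcs)
    (by simpa using hX.continuous.integrable_of_hasCompactSupport hc)
    (by simp) (fun x _ => hX.differentiable (by norm_num) x)
  simpa using this

lemma norm_eb {d : ℕ} (i : Fin d) : ‖(eb i : Euc d)‖ = 1 := by simp [eb]

lemma contDiff_fderiv_eb {d : ℕ} {u : Euc d → ℝ} (hu : ContDiff ℝ 2 u) (v : Euc d) :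
    ContDiff ℝ 1 (fun x => fderiv ℝ u x v) := by
  have : ContDiff ℝ 1 (fderiv ℝ u) := hu.fderiv_right (by norm_num)
  exact this.clm_apply contDiff_const

lemma fderiv_fderiv_apply {d : ℕ} {u : Euc d → ℝ} (hu : ContDiff ℝ 2 u) (x v w : Euc d) :
    fderiv ℝ (fun x => fderiv ℝ u x v) x w = fderiv ℝ (fderiv ℝ u) x w v := by
  have h1 : ContDiff ℝ 1 (fderiv ℝ u) := hu.fderiv_right (by norm_num)
  have h2 := (h1.differentiable (by norm_num) x).hasFDerivAt
  have h3 := h2.clm_apply (hasFDerivAt_const v x)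
  rw [h3.fderiv]; simp

end Part1

section Part2

open MeasureTheory Metric Filter

lemma integrable_of_tsupp {d : ℕ} {f g : Euc d → ℝ} (hf : Continuous f)
    (hg : HasCompactSupport g) (h : ∀ x, x ∉ tsupport g → f x = 0) : Integrable f :=
  hf.integrable_of_hasCompactSupport (HasCompactSupport.intro hg.isCompact (fun x hx => h x hx))

lemma poincare_ball {d : ℕ} (i : Fin d) {ψ : Euc d → ℝ} (hψ : ContDiff ℝ 1 ψ)
    (hc : HasCompactSupport ψ) (y₀ : Euc d) {r : ℝ}
    (hs : tsupport ψ ⊆ closedBall y₀ r) :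
    ∫ x, ψ x ^ 2 ≤ 4 * r ^ 2 * ∫ x, ‖fderiv ℝ ψ x‖ ^ 2 := by
  set X : Euc d → ℝ := fun x => ψ x ^ 2 * (x i - y₀ i) with hXdef
  have hcoord : ContDiff ℝ 1 (fun x : Euc d => x i - y₀ i) := by fun_prop
  have hX : ContDiff ℝ 1 X := (hψ.pow 2).mul hcoord
  have hXc : HasCompactSupport X := by
    refine HasCompactSupport.intro hc.isCompact (fun x hx => ?_)
    simp [hXdef, image_eq_zero_of_notMem_tsupport hx]
  have h0 := integral_fderiv_zero hX hXc (eb i)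
  have hder : ∀ x, fderiv ℝ X x (eb i)
      = ψ x ^ 2 + 2 * ψ x * fderiv ℝ ψ x (eb i) * (x i - y₀ i) := by
    intro x
    have h1 := ((hψ.differentiable (by norm_num) x).hasFDerivAt.pow 2)
    have h2 : HasFDerivAt (fun x : Euc d => x i - y₀ i)
        (EuclideanSpace.proj i : Euc d →L[ℝ] ℝ) x :=
      ((EuclideanSpace.proj i : Euc d →L[ℝ] ℝ).hasFDerivAt).sub_const _
    have h3 := h1.mul h2
    have : fderiv ℝ X x = _ := h3.fderiv
    rw [this]
    simp [eb]
    ring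
  have hfc : Continuous fun x => fderiv ℝ ψ x := hψ.continuous_fderiv (by norm_num)
  have hψc := hψ.continuous
  have hz : ∀ x, x ∉ tsupport ψ → ψ x = 0 := fun x hx => image_eq_zero_of_notMem_tsupport hx
  have hz' : ∀ x, x ∉ tsupport ψ → fderiv ℝ ψ x = 0 := fun x hx =>
    fderiv_of_notMem_tsupport ℝ hx
  have i1 : Integrable fun x => ψ x ^ 2 :=
    integrable_of_tsupp (by fun_prop) hc (fun x hx => by simp [hz x hx])
  have i2 : Integrable fun x => ‖fderiv ℝ ψ x‖ ^ 2 :=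
    integrable_of_tsupp (by fun_prop) hc (fun x hx => by simp [hz' x hx])
  have i3 : Integrable fun x => fderiv ℝ X x (eb i) := by
    have : Continuous (fderiv ℝ X) := hX.continuous_fderiv (by norm_num)
    exact integrable_of_tsupp (by fun_prop) hXc
      (fun x hx => by simp [fderiv_of_notMem_tsupport ℝ hx])
  have hpt : ∀ x, (1/2) * ψ x ^ 2 - 2 * r ^ 2 * ‖fderiv ℝ ψ x‖ ^ 2 ≤ fderiv ℝ X x (eb i) := by
    intro x
    rw [hder]
    by_cases hx : x ∈ tsupport ψ
    · have hb := hs hx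
      rw [mem_closedBall, dist_eq_norm] at hb
      have hi : |x i - y₀ i| ≤ ‖x - y₀‖ := by
        simpa using PiLp.norm_apply_le (x - y₀) i
      have h1 : |fderiv ℝ ψ x (eb i)| ≤ ‖fderiv ℝ ψ x‖ := by
        have := (fderiv ℝ ψ x).le_opNorm (eb i)
        rwa [norm_eb, mul_one] at this
      set a := fderiv ℝ ψ x (eb i)
      set b := x i - y₀ i
      have hb2 : |a * b| ≤ ‖fderiv ℝ ψ x‖ * r := by
        rw [abs_mul]; gcongr; exact hi.trans hb
      have hb3 : (a * b) ^ 2 ≤ (‖fderiv ℝ ψ x‖ * r) ^ 2 := sq_le_sq' (by linarith [neg_abs_le (a*b)]) ((le_abs_self _).trans hb2)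
      nlinarith [sq_nonneg (ψ x + 2 * (a * b))]
    · simp [hz x hx, hz' x hx]
  have := integral_mono ((i1.const_mul (1/2)).sub (i2.const_mul (2 * r ^ 2))) i3 hpt
  rw [h0] at this
  simp only [Pi.sub_apply] at this
  rw [integral_sub (i1.const_mul (1/2)) (i2.const_mul (2 * r ^ 2)), integral_const_mul,
    integral_const_mul] at this
  linarith

lemma energy_identity {d : ℕ} {u χ : Euc d → ℝ} (hu : ContDiff ℝ 2 u) (hχ : ContDiff ℝ 1 χ)
    (hc : HasCompactSupport χ) :
    ∫ x, ‖fderiv ℝ (fun x => χ x * u x) x‖ ^ 2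
      = ∫ x, (‖fderiv ℝ χ x‖ ^ 2 * u x ^ 2 - χ x ^ 2 * u x * laplacian u x) := by
  have hu1 : ContDiff ℝ 1 u := hu.of_le (by norm_num)
  set X : Fin d → Euc d → ℝ := fun i x => χ x ^ 2 * u x * fderiv ℝ u x (eb i) with hXdef
  have hX : ∀ i, ContDiff ℝ 1 (X i) := fun i =>
    ((hχ.pow 2).mul hu1).mul (contDiff_fderiv_eb hu _)
  have hXc : ∀ i, HasCompactSupport (X i) := by
    intro i
    refine HasCompactSupport.intro hc.isCompact (fun x hx => ?_)
    simp [hXdef, image_eq_zero_of_notMem_tsupport hx]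
  have hXi : ∀ i, Integrable fun x => fderiv ℝ (X i) x (eb i) := by
    intro i
    have : Continuous (fderiv ℝ (X i)) := (hX i).continuous_fderiv (by norm_num)
    exact integrable_of_tsupp (by fun_prop) (hXc i)
      (fun x hx => by simp [fderiv_of_notMem_tsupport ℝ hx])
  have h0 : ∫ x, ∑ i, fderiv ℝ (X i) x (eb i) = 0 := by
    rw [integral_finsetSum _ (fun i _ => hXi i)]
    exact Finset.sum_eq_zero fun i _ => integral_fderiv_zero (hX i) (hXc i) _
  have hder : ∀ i x, fderiv ℝ (X i) x (eb i) = 2 * χ x * fderiv ℝ χ x (eb i) * u x * fderiv ℝ u x (eb i)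
      + χ x ^ 2 * fderiv ℝ u x (eb i) ^ 2
      + χ x ^ 2 * u x * fderiv ℝ (fderiv ℝ u) x (eb i) (eb i) := by
    intro i x
    have h1 := ((hχ.differentiable (by norm_num) x).hasFDerivAt.pow 2)
    have h2 := (hu1.differentiable (by norm_num) x).hasFDerivAt
    have h4 := ((contDiff_fderiv_eb hu (eb i)).differentiable (by norm_num) x).hasFDerivAt
    have h3 := (h1.mul h2).mul h4
    have : fderiv ℝ (X i) x = _ := h3.fderiv
    rw [this]
    simp [fderiv_fderiv_apply hu]
    ring
  have hprod : ∀ x v, fderiv ℝ (fun x => χ x * u x) x v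
      = χ x * fderiv ℝ u x v + u x * fderiv ℝ χ x v := by
    intro x v
    have h1 := (hχ.differentiable (by norm_num) x).hasFDerivAt
    have h2 := (hu1.differentiable (by norm_num) x).hasFDerivAt
    have h3 : fderiv ℝ (fun x => χ x * u x) x = _ := (h1.mul h2).fderiv
    rw [h3]; simp
  have hpt : ∀ x, ‖fderiv ℝ (fun x => χ x * u x) x‖ ^ 2
      = (‖fderiv ℝ χ x‖ ^ 2 * u x ^ 2 - χ x ^ 2 * u x * laplacian u x)
        + ∑ i, fderiv ℝ (X i) x (eb i) := by
    intro x
    rw [norm_sq_dual, norm_sq_dual, laplacian, Finset.sum_mul, Finset.mul_sum,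
      ← Finset.sum_sub_distrib, ← Finset.sum_add_distrib]
    refine Finset.sum_congr rfl fun i _ => ?_
    rw [hder, hprod]; ring
  have hi1 : Integrable fun x => ∑ i, fderiv ℝ (X i) x (eb i) :=
    integrable_finsetSum _ fun i _ => hXi i
  have hi2 : Integrable fun x => ‖fderiv ℝ χ x‖ ^ 2 * u x ^ 2 - χ x ^ 2 * u x * laplacian u x := by
    have c1 : Continuous (fderiv ℝ χ) := hχ.continuous_fderiv (by norm_num)
    have c2 : Continuous u := hu.continuous
    have c3 : Continuous χ := hχ.continuous
    have c4 : Continuous (laplacian u) := by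
      have h1 : ContDiff ℝ 1 (fderiv ℝ u) := hu.fderiv_right (by norm_num)
      have : Continuous (fderiv ℝ (fderiv ℝ u)) := h1.continuous_fderiv (by norm_num)
      unfold laplacian
      fun_prop
    exact integrable_of_tsupp (by fun_prop) hc (fun x hx => by
      simp [fderiv_of_notMem_tsupport ℝ hx, image_eq_zero_of_notMem_tsupport hx])
  calc _ = ∫ x, ((‖fderiv ℝ χ x‖ ^ 2 * u x ^ 2 - χ x ^ 2 * u x * laplacian u x)
        + ∑ i, fderiv ℝ (X i) x (eb i)) := by simp_rw [hpt]
    _ = _ := by rw [integral_add hi2 hi1, h0, add_zero]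

lemma continuous_laplacian {d : ℕ} {u : Euc d → ℝ} (hu : ContDiff ℝ 2 u) :
    Continuous (laplacian u) := by
  have h1 : ContDiff ℝ 1 (fderiv ℝ u) := hu.fderiv_right (by norm_num)
  have : Continuous (fderiv ℝ (fderiv ℝ u)) := h1.continuous_fderiv (by norm_num)
  unfold laplacian
  fun_prop

end Part2

section Part3

open MeasureTheory Metric Filter

lemma setInt_eq {d : ℕ} {Ω : Set (Euc d)} {φ f : Euc d → ℝ} (hs : tsupport φ ⊆ Ω)
    (hf : ∀ x, x ∉ tsupport φ → f x = 0) : ∫ x in Ω, f x = ∫ x, f x :=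
  setIntegral_eq_integral_of_forall_compl_eq_zero (fun x hx => hf x (fun h => hx (hs h)))

lemma rayleigh_num {d : ℕ} {Ω : Set (Euc d)} (V : Euc d → ℝ) {φ : Euc d → ℝ} (hs : tsupport φ ⊆ Ω) :
    ∫ x in Ω, (‖gradient φ x‖ ^ 2 + V x * (φ x) ^ 2)
      = ∫ x, (‖fderiv ℝ φ x‖ ^ 2 + V x * (φ x) ^ 2) := by
  rw [setInt_eq hs]
  · simp_rw [norm_gradient]
  · intro x hx
    simp [norm_gradient, fderiv_of_notMem_tsupport ℝ hx, image_eq_zero_of_notMem_tsupport hx]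

lemma rayleigh_den {d : ℕ} {Ω : Set (Euc d)} {φ : Euc d → ℝ} (hs : tsupport φ ⊆ Ω) :
    ∫ x in Ω, (φ x) ^ 2 = ∫ x, (φ x) ^ 2 :=
  setInt_eq hs (fun x hx => by simp [image_eq_zero_of_notMem_tsupport hx])

lemma int_sq_pos {d : ℕ} {φ : Euc d → ℝ} (hφ : Continuous φ) (hc : HasCompactSupport φ)
    (h0 : φ ≠ 0) : 0 < ∫ x, (φ x) ^ 2 := by
  obtain ⟨x, hx⟩ := Function.ne_iff.1 h0
  refine (hφ.pow 2).integral_pos_of_hasCompactSupport_nonneg_nonzero (x := x) ?_ ?_ ?_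
  · exact HasCompactSupport.intro hc.isCompact
      (fun x hx => by simp [image_eq_zero_of_notMem_tsupport hx])
  · intro x; simp; positivity
  · simpa using hx

lemma forward_dir {d : ℕ} (i : Fin d) (y₀ : Euc d) {r : ℝ} (hr : 0 < r) {V : Euc d → ℝ}
    (hV : Continuous V) (lam : ℝ) {u : Euc d → ℝ}
    (hu0 : ContinuousOn u (closure (ball y₀ r))) (hu2 : ContDiffOn ℝ 2 u (ball y₀ r))
    (hueq : ∀ x ∈ ball y₀ r, -laplacian u x + V x * u x = lam * u x)
    (hupos : ∀ x ∈ closure (ball y₀ r), 0 < u x) :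
    lam < lambda0 (ball y₀ r) V := by
  rw [closure_ball y₀ hr.ne'] at hu0 hupos
  have hK : IsCompact (closedBall y₀ r) := isCompact_closedBall _ _
  have hne : (closedBall y₀ r).Nonempty := ⟨y₀, by simp [hr.le]⟩
  obtain ⟨xm, hxm, hm⟩ := hK.exists_isMinOn hne hu0
  obtain ⟨xM, hxM, hM⟩ := hK.exists_isMaxOn hne hu0
  set m := u xm
  set M := u xM
  have hm0 : 0 < m := hupos _ hxm
  have hM0 : 0 < M := hupos _ hxM
  set c := m ^ 2 / (4 * r ^ 2 * M ^ 2) with hc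
  have hc0 : 0 < c := by positivity
  refine lt_of_lt_of_le (lt_add_of_pos_right lam hc0) ?_
  refine le_csInf ?_ ?_
  · let b : ContDiffBump y₀ := ⟨r / 3, r / 2, by positivity, by linarith⟩
    refine ⟨_, b, b.contDiff, b.hasCompactSupport, ?_, ?_, rfl⟩
    · rw [b.tsupport_eq]; exact closedBall_subset_ball (by show r / 2 < r; linarith)
    · intro h
      have := congrFun h y₀
      rw [b.one_of_mem_closedBall (by simp [b.rIn_pos.le])] at this
      simp at this
  · rintro q ⟨φ, hφ, hφc, hφs, hφ0, rfl⟩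
    rw [rayleigh_num V hφs, rayleigh_den hφs, le_div_iff₀ (int_sq_pos hφ.continuous hφc hφ0)]
    obtain ⟨r', hr', hr's⟩ := exists_lt_subset_ball (isClosed_tsupport φ) hφs
    set ρ := max r' (r / 2) with hρ
    have hρ1 : ρ < r := max_lt hr' (by linarith)
    have hρ0 : 0 < ρ := lt_of_lt_of_le (by positivity) (le_max_right _ _)
    have hφρ : tsupport φ ⊆ ball y₀ ρ := hr's.trans (ball_subset_ball (le_max_left _ _))
    let b : ContDiffBump y₀ := ⟨ρ, (ρ + r) / 2, hρ0, by linarith⟩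
    set w : Euc d → ℝ := fun x => b x * u x + (1 - b x) with hw
    have hwu : ∀ x ∈ closedBall y₀ ρ, w x = u x := by
      intro x hx
      have : b x = 1 := b.one_of_mem_closedBall hx
      simp [hw, this]
    have hbs : tsupport b ⊆ ball y₀ r := by
      rw [b.tsupport_eq]; exact closedBall_subset_ball (by show (ρ + r) / 2 < r; linarith)
    have hw2 : ContDiff ℝ 2 w := by
      rw [contDiff_iff_contDiffAt]
      intro x
      by_cases hx : x ∈ ball y₀ r
      · have h1 : ContDiffAt ℝ 2 u x := hu2.contDiffAt (isOpen_ball.mem_nhds hx)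
        have h2 : ContDiffAt ℝ 2 b x := b.contDiff.contDiffAt
        exact (h2.mul h1).add (contDiffAt_const.sub h2)
      · have hx' : x ∉ tsupport b := fun h => hx (hbs h)
        have : w =ᶠ[nhds x] fun _ => 1 := by
          have h3 := notMem_tsupport_iff_eventuallyEq.1 hx'
          filter_upwards [h3] with z hz
          simp [hw, hz]
        exact contDiffAt_const.congr_of_eventuallyEq this
    have hwpos : ∀ x, 0 < w x := by
      intro x
      by_cases hx : x ∈ ball y₀ r
      · have h1 := hupos x (ball_subset_closedBall hx)
        have h2 : 0 ≤ b x := b.nonneg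
        have h3 : b x ≤ 1 := b.le_one
        rcases h2.eq_or_lt with h | h
        · simp [hw, ← h]
        · have := mul_pos h h1
          simp only [hw]; linarith
      · have hx' : x ∉ tsupport b := fun h => hx (hbs h)
        simp [hw, image_eq_zero_of_notMem_tsupport hx']
    have hlap : ∀ x ∈ ball y₀ ρ, laplacian w x = (V x - lam) * w x := by
      intro x hx
      have he : w =ᶠ[nhds x] u := by
        filter_upwards [isOpen_ball.mem_nhds hx] with z hz
        exact hwu z (ball_subset_closedBall hz)
      have : laplacian w x = laplacian u x := by
        unfold laplacian
        rw [he.fderiv.fderiv_eq]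
      rw [this, hwu x (ball_subset_closedBall hx)]
      linarith [hueq x (ball_subset_ball hρ1.le hx)]
    set ψ : Euc d → ℝ := fun x => φ x / w x with hψ
    have hφ1 : ContDiff ℝ 1 φ := hφ.of_le (by exact_mod_cast le_top)
    have hψ1 : ContDiff ℝ 1 ψ := hφ1.div (hw2.of_le (by norm_num)) (fun x => (hwpos x).ne')
    have hψc : HasCompactSupport ψ := HasCompactSupport.intro hφc.isCompact
      (fun x hx => by simp [hψ, image_eq_zero_of_notMem_tsupport hx])
    have hψs : tsupport ψ ⊆ tsupport φ := closure_mono (fun x hx h => hx (by simp [hψ, h]))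
    have hφψ : φ = fun x => ψ x * w x := by
      funext x; simp [hψ, (hwpos x).ne']
    have hE := energy_identity hw2 hψ1 hψc
    rw [← hφψ] at hE
    have hP := poincare_ball i hψ1 hψc y₀ (r := r)
      ((hψs.trans hφs).trans ball_subset_closedBall)
    have c1 : Continuous (fderiv ℝ φ) := hφ1.continuous_fderiv (by norm_num)
    have c2 : Continuous (fderiv ℝ ψ) := hψ1.continuous_fderiv (by norm_num)
    have c3 := hφ1.continuous
    have c4 := hψ1.continuous
    have c5 := hw2.continuous
    have c6 := continuous_laplacian hw2
    have j1 : Integrable fun x => ‖fderiv ℝ φ x‖ ^ 2 := integrable_of_tsupp (by fun_prop) hφc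
      (fun x hx => by simp [fderiv_of_notMem_tsupport ℝ hx])
    have j2 : Integrable fun x => V x * φ x ^ 2 := integrable_of_tsupp (by fun_prop) hφc
      (fun x hx => by simp [image_eq_zero_of_notMem_tsupport hx])
    have j3 : Integrable fun x => φ x ^ 2 := integrable_of_tsupp (by fun_prop) hφc
      (fun x hx => by simp [image_eq_zero_of_notMem_tsupport hx])
    have j4 : Integrable fun x => ‖fderiv ℝ ψ x‖ ^ 2 := integrable_of_tsupp (by fun_prop) hψc
      (fun x hx => by simp [fderiv_of_notMem_tsupport ℝ hx])
    have j5 : Integrable fun x => ψ x ^ 2 := integrable_of_tsupp (by fun_prop) hψc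
      (fun x hx => by simp [image_eq_zero_of_notMem_tsupport hx])
    have j6 : Integrable fun x => ‖fderiv ℝ ψ x‖ ^ 2 * w x ^ 2 - ψ x ^ 2 * w x * laplacian w x :=
      integrable_of_tsupp (by fun_prop) hψc (fun x hx => by
        simp [fderiv_of_notMem_tsupport ℝ hx, image_eq_zero_of_notMem_tsupport hx])
    rw [integral_add j1 j2, hE, ← integral_add j6 j2]
    have hpt : ∀ x, m ^ 2 * ‖fderiv ℝ ψ x‖ ^ 2 + lam * φ x ^ 2 ≤
        ‖fderiv ℝ ψ x‖ ^ 2 * w x ^ 2 - ψ x ^ 2 * w x * laplacian w x + V x * φ x ^ 2 := by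
      intro x
      by_cases hx : x ∈ tsupport φ
      · have hxρ := hφρ hx
        rw [hlap x hxρ]
        have e1 : φ x = ψ x * w x := congrFun hφψ x
        have e2 : m ≤ w x := by
          rw [hwu x (ball_subset_closedBall hxρ)]
          exact hm (closedBall_subset_closedBall hρ1.le (ball_subset_closedBall hxρ))
        rw [e1]
        have : m ^ 2 ≤ w x ^ 2 := by gcongr
        nlinarith [sq_nonneg (‖fderiv ℝ ψ x‖)]
      · have hx' : x ∉ tsupport ψ := fun h => hx (hψs h)
        simp [fderiv_of_notMem_tsupport ℝ hx', image_eq_zero_of_notMem_tsupport hx',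
          image_eq_zero_of_notMem_tsupport hx]
    have h1 := integral_mono ((j4.const_mul (m ^ 2)).add (j3.const_mul lam)) (j6.add j2) hpt
    simp only [Pi.add_apply] at h1
    rw [integral_add (j4.const_mul (m ^ 2)) (j3.const_mul lam), integral_const_mul,
      integral_const_mul] at h1
    have hpt2 : ∀ x, φ x ^ 2 ≤ M ^ 2 * ψ x ^ 2 := by
      intro x
      by_cases hx : x ∈ tsupport φ
      · have hxρ := hφρ hx
        have e1 : φ x = ψ x * w x := congrFun hφψ x
        have e2 : w x ≤ M := by
          rw [hwu x (ball_subset_closedBall hxρ)]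
          exact hM (closedBall_subset_closedBall hρ1.le (ball_subset_closedBall hxρ))
        have e3 := (hwpos x).le
        rw [e1, mul_pow, mul_comm]
        gcongr
      · rw [image_eq_zero_of_notMem_tsupport hx]; simp; positivity
    have h2 := integral_mono j3 (j5.const_mul (M ^ 2)) hpt2
    rw [integral_const_mul] at h2
    refine le_trans ?_ h1
    have h3 : c * ∫ x, φ x ^ 2 ≤ m ^ 2 * ∫ x, ‖fderiv ℝ ψ x‖ ^ 2 := by
      calc c * ∫ x, φ x ^ 2 ≤ c * (M ^ 2 * ∫ x, ψ x ^ 2) := by gcongr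
        _ ≤ c * (M ^ 2 * (4 * r ^ 2 * ∫ x, ‖fderiv ℝ ψ x‖ ^ 2)) := by gcongr
        _ = _ := by rw [hc]; field_simp
    linarith

end Part3

section Part4

open MeasureTheory Metric Filter
open scoped Convolution

lemma rayleigh_smooth {d : ℕ} {Ω : Set (Euc d)} {V : Euc d → ℝ} (hV : Continuous V) {K : ℝ}
    (hK : ∀ x, |V x| ≤ K) {φ : Euc d → ℝ} (hφ : ContDiff ℝ (⊤ : ℕ∞) φ)
    (hc : HasCompactSupport φ) (hs : tsupport φ ⊆ Ω) :
    lambda0 Ω V * ∫ x, φ x ^ 2 ≤ ∫ x, (‖fderiv ℝ φ x‖ ^ 2 + V x * (φ x) ^ 2) := by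
  by_cases h0 : φ = 0
  · subst h0
    simp
  rw [← le_div_iff₀ (int_sq_pos hφ.continuous hc h0)]
  refine csInf_le ⟨-K, ?_⟩ ⟨φ, hφ, hc, hs, h0, ?_⟩
  · rintro q ⟨ψ, hψ, hψc, hψs, hψ0, rfl⟩
    rw [rayleigh_num V hψs, rayleigh_den hψs, le_div_iff₀ (int_sq_pos hψ.continuous hψc hψ0)]
    have hψ1 : ContDiff ℝ 1 ψ := hψ.of_le (by exact_mod_cast le_top)
    have c1 : Continuous (fderiv ℝ ψ) := hψ1.continuous_fderiv (by norm_num)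
    have c3 := hψ1.continuous
    rw [← integral_const_mul]
    refine integral_mono ?_ ?_ ?_
    · exact integrable_of_tsupp (by fun_prop) hψc
        (fun x hx => by simp [image_eq_zero_of_notMem_tsupport hx])
    · exact integrable_of_tsupp (by fun_prop) hψc
        (fun x hx => by simp [image_eq_zero_of_notMem_tsupport hx, fderiv_of_notMem_tsupport ℝ hx])
    · intro x
      have := (abs_le.1 (hK x)).1
      have h2 := sq_nonneg (ψ x)
      have h3 := sq_nonneg (‖fderiv ℝ ψ x‖)
      simp only
      nlinarith
  · rw [rayleigh_num V hs, rayleigh_den hs]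

lemma mollify {d : ℕ} {Ω : Set (Euc d)} (hΩ : IsOpen Ω) {φ : Euc d → ℝ} (hφ : ContDiff ℝ 1 φ)
    (hc : HasCompactSupport φ) (hs : tsupport φ ⊆ Ω) :
    ∃ K' : Set (Euc d), IsCompact K' ∧ K' ⊆ Ω ∧ ∀ ε > 0, ∃ φ' : Euc d → ℝ,
      ContDiff ℝ (⊤ : ℕ∞) φ' ∧ tsupport φ' ⊆ K' ∧ (∀ x, dist (φ' x) (φ x) ≤ ε) ∧
      ∀ x, dist (fderiv ℝ φ' x) (fderiv ℝ φ x) ≤ ε := by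
  obtain ⟨δ, hδ, hδs⟩ := hc.isCompact.exists_cthickening_subset_open hΩ hs
  refine ⟨cthickening δ (tsupport φ), hc.isCompact.cthickening, hδs, fun ε hε => ?_⟩
  have c1 : Continuous (fderiv ℝ φ) := hφ.continuous_fderiv (by norm_num)
  have u1 : UniformContinuous φ := hc.uniformContinuous_of_continuous hφ.continuous
  have u2 : UniformContinuous (fderiv ℝ φ) :=
    (hc.fderiv (𝕜 := ℝ)).uniformContinuous_of_continuous c1
  obtain ⟨δ1, hδ1, h1⟩ := Metric.uniformContinuous_iff.1 u1 ε hε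
  obtain ⟨δ2, hδ2, h2⟩ := Metric.uniformContinuous_iff.1 u2 ε hε
  set ρ := min δ (min δ1 δ2) with hρ
  have hρ0 : 0 < ρ := lt_min hδ (lt_min hδ1 hδ2)
  let b : ContDiffBump (0 : Euc d) := ⟨ρ / 2, ρ, by positivity, by linarith⟩
  have hb : b.rOut = ρ := rfl
  have hli : LocallyIntegrable (b.normed volume) volume :=
    (b.continuous_normed).locallyIntegrable
  set φ' : Euc d → ℝ := (b.normed volume ⋆[ContinuousLinearMap.lsmul ℝ ℝ, volume] φ) with hφ'
  have hder : ∀ x, fderiv ℝ φ' x =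
      (b.normed volume ⋆[ContinuousLinearMap.lsmul ℝ ℝ, volume] (fderiv ℝ φ)) x := by
    intro x
    have := HasCompactSupport.hasFDerivAt_convolution_right (ContinuousLinearMap.lsmul ℝ ℝ)
      hc hli hφ x
    rw [this.fderiv]
    rfl
  refine ⟨φ', ?_, ?_, ?_, ?_⟩
  · exact b.hasCompactSupport_normed.contDiff_convolution_left _ b.contDiff_normed
      hφ.continuous.locallyIntegrable
  · refine closure_minimal ?_ isClosed_cthickening
    intro x hx
    by_contra hx'
    apply hx
    have hz : ∀ y ∈ ball x b.rOut, φ y = 0 := by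
      intro y hy
      apply image_eq_zero_of_notMem_tsupport
      intro hy2
      apply hx'
      refine mem_cthickening_of_dist_le x y δ _ hy2 ?_
      rw [mem_ball, dist_comm] at hy
      exact hy.le.trans (min_le_left _ _)
    have hx0 : φ x = 0 := hz x (mem_ball_self b.rOut_pos)
    have := b.dist_normed_convolution_le (μ := volume) (g := φ) (x₀ := x) (ε := 0)
      hφ.continuous.aestronglyMeasurable (fun y hy => by rw [hz y hy, hx0]; simp)
    rw [hx0] at this
    simpa using this
  · intro x
    refine b.dist_normed_convolution_le (μ := volume) (g := φ) (x₀ := x)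
      hφ.continuous.aestronglyMeasurable (fun y hy => (h1 (lt_of_lt_of_le hy ?_)).le)
    exact (min_le_right _ _).trans (min_le_left _ _)
  · intro x
    rw [hder]
    refine b.dist_normed_convolution_le (μ := volume) (g := fderiv ℝ φ) (x₀ := x)
      c1.aestronglyMeasurable (fun y hy => (h2 (lt_of_lt_of_le hy ?_)).le)
    exact (min_le_right _ _).trans (min_le_right _ _)

lemma rayleigh_C1 {d : ℕ} {Ω : Set (Euc d)} (hΩ : IsOpen Ω) {V : Euc d → ℝ} (hV : Continuous V)
    {K : ℝ} (hK : ∀ x, |V x| ≤ K) {φ : Euc d → ℝ} (hφ : ContDiff ℝ 1 φ)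
    (hc : HasCompactSupport φ) (hs : tsupport φ ⊆ Ω) :
    lambda0 Ω V * ∫ x, φ x ^ 2 ≤ ∫ x, (‖fderiv ℝ φ x‖ ^ 2 + V x * (φ x) ^ 2) := by
  obtain ⟨K', hK'c, hK's, H⟩ := mollify hΩ hφ hc hs
  choose Φ hΦ1 hΦ2 hΦ3 hΦ4 using fun n : ℕ => H (1 / ((n : ℝ) + 1)) (by positivity)
  have hlim : Tendsto (fun n : ℕ => 1 / ((n : ℝ) + 1)) atTop (nhds 0) :=
    tendsto_one_div_add_atTop_nhds_zero_nat
  have t1 : ∀ x, Tendsto (fun n => Φ n x) atTop (nhds (φ x)) := fun x =>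
    tendsto_iff_dist_tendsto_zero.2 (squeeze_zero (fun _ => dist_nonneg) (fun n => hΦ3 n x) hlim)
  have t2 : ∀ x, Tendsto (fun n => fderiv ℝ (Φ n) x) atTop (nhds (fderiv ℝ φ x)) := fun x =>
    tendsto_iff_dist_tendsto_zero.2 (squeeze_zero (fun _ => dist_nonneg) (fun n => hΦ4 n x) hlim)
  have c1 : Continuous (fderiv ℝ φ) := hφ.continuous_fderiv (by norm_num)
  obtain ⟨A, hA⟩ := hφ.continuous.bounded_above_of_compact_support hc
  obtain ⟨B, hB⟩ := c1.bounded_above_of_compact_support (hc.fderiv (𝕜 := ℝ))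
  have hle1 : ∀ n : ℕ, 1 / ((n : ℝ) + 1) ≤ 1 := by
    intro n; rw [div_le_one (by positivity)]; linarith [n.cast_nonneg (α := ℝ)]
  have b1 : ∀ n x, |Φ n x| ≤ A + 1 := by
    intro n x
    have h1 := (hΦ3 n x).trans (hle1 n)
    have h2 := hA x
    rw [Real.dist_eq] at h1
    rw [Real.norm_eq_abs] at h2
    have := abs_add_le (Φ n x - φ x) (φ x)
    rw [sub_add_cancel] at this
    linarith
  have b2 : ∀ n x, ‖fderiv ℝ (Φ n) x‖ ≤ B + 1 := by
    intro n x
    have h1 := (hΦ4 n x).trans (hle1 n)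
    have h2 := hB x
    rw [dist_eq_norm] at h1
    have := norm_add_le (fderiv ℝ (Φ n) x - fderiv ℝ φ x) (fderiv ℝ φ x)
    rw [sub_add_cancel] at this
    linarith
  have hcs : ∀ n, HasCompactSupport (Φ n) := fun n =>
    hK'c.of_isClosed_subset (isClosed_tsupport _) (hΦ2 n)
  have hC1 : ∀ n, ContDiff ℝ 1 (Φ n) := fun n => (hΦ1 n).of_le (by exact_mod_cast le_top)
  have cc1 : ∀ n, Continuous (fderiv ℝ (Φ n)) := fun n => (hC1 n).continuous_fderiv (by norm_num)
  have cc2 : ∀ n, Continuous (Φ n) := fun n => (hC1 n).continuous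
  have hind : Integrable (K'.indicator fun _ : Euc d => (1 : ℝ)) :=
    (integrable_indicator_iff hK'c.measurableSet).2
      (integrableOn_const (hK'c.measure_lt_top.ne))
  have T1 : Tendsto (fun n => ∫ x, Φ n x ^ 2) atTop (nhds (∫ x, φ x ^ 2)) := by
    refine tendsto_integral_of_dominated_convergence
      (fun x => (A + 1) ^ 2 * K'.indicator (fun _ => 1) x)
      (fun n => ((cc2 n).pow 2).aestronglyMeasurable) (hind.const_mul _) ?_ ?_
    · intro n
      refine Eventually.of_forall fun x => ?_
      by_cases hx : x ∈ K'
      · simp only [Set.indicator_of_mem hx, mul_one, Real.norm_eq_abs, abs_pow]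
        gcongr; exact b1 n x
      · have : x ∉ tsupport (Φ n) := fun h => hx (hΦ2 n h)
        simp [image_eq_zero_of_notMem_tsupport this, hx]
    · exact Eventually.of_forall fun x => (t1 x).pow 2
  have T2 : Tendsto (fun n => ∫ x, (‖fderiv ℝ (Φ n) x‖ ^ 2 + V x * (Φ n x) ^ 2)) atTop
      (nhds (∫ x, (‖fderiv ℝ φ x‖ ^ 2 + V x * (φ x) ^ 2))) := by
    refine tendsto_integral_of_dominated_convergence
      (fun x => ((B + 1) ^ 2 + K * (A + 1) ^ 2) * K'.indicator (fun _ => 1) x)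
      (fun n => ?_) (hind.const_mul _) ?_ ?_
    · have := cc1 n
      have := cc2 n
      exact Continuous.aestronglyMeasurable (by fun_prop)
    · intro n
      refine Eventually.of_forall fun x => ?_
      by_cases hx : x ∈ K'
      · simp only [Set.indicator_of_mem hx, mul_one, Real.norm_eq_abs]
        refine (abs_add_le _ _).trans ?_
        rw [abs_mul, abs_pow, abs_pow, abs_norm]
        have hK0 : 0 ≤ K := (abs_nonneg _).trans (hK x)
        gcongr
        · exact b2 n x
        · exact hK x
        · exact b1 n x
      · have : x ∉ tsupport (Φ n) := fun h => hx (hΦ2 n h)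
        simp [image_eq_zero_of_notMem_tsupport this, hx, fderiv_of_notMem_tsupport ℝ this]
    · exact Eventually.of_forall fun x => ((t2 x).norm.pow 2).add (((t1 x).pow 2).const_mul _)
  exact le_of_tendsto_of_tendsto' (T1.const_mul _) T2 fun n =>
    rayleigh_smooth hV hK (hΦ1 n) (hcs n) ((hΦ2 n).trans hK's)

end Part4

section Part5

open MeasureTheory Metric Filter

/-- Bounded and globally Hölder continuous functions. -/
def BH {d : ℕ} (α : ℝ) (h : Euc d → ℝ) : Prop :=
  (∃ M, ∀ x, |h x| ≤ M) ∧ ∃ C, 0 ≤ C ∧ ∀ x y, |h x - h y| ≤ C * ‖x - y‖ ^ α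

lemma BH.add {d : ℕ} {α : ℝ} {f g : Euc d → ℝ} (hf : BH α f) (hg : BH α g) :
    BH α (fun x => f x + g x) := by
  obtain ⟨⟨M, hM⟩, C, hC, hfC⟩ := hf
  obtain ⟨⟨M', hM'⟩, C', hC', hgC⟩ := hg
  refine ⟨⟨M + M', fun x => (abs_add_le _ _).trans (add_le_add (hM x) (hM' x))⟩,
    C + C', by positivity, fun x y => ?_⟩
  have := abs_add_le (f x - f y) (g x - g y)
  have h1 := hfC x y
  have h2 := hgC x y
  rw [show f x + g x - (f y + g y) = f x - f y + (g x - g y) by ring]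
  linarith

lemma BH.mul {d : ℕ} {α : ℝ} {f g : Euc d → ℝ} (hf : BH α f) (hg : BH α g) :
    BH α (fun x => f x * g x) := by
  obtain ⟨⟨M, hM⟩, C, hC, hfC⟩ := hf
  obtain ⟨⟨M', hM'⟩, C', hC', hgC⟩ := hg
  have hM0 : 0 ≤ M := (abs_nonneg _).trans (hM 0)
  have hM0' : 0 ≤ M' := (abs_nonneg _).trans (hM' 0)
  refine ⟨⟨M * M', fun x => by rw [abs_mul]; gcongr; exacts [hM x, hM' x]⟩,
    C * M' + M * C', by positivity, fun x y => ?_⟩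
  rw [show f x * g x - f y * g y = (f x - f y) * g x + f y * (g x - g y) by ring]
  refine (abs_add_le _ _).trans ?_
  rw [abs_mul, abs_mul]
  calc _ ≤ (C * ‖x - y‖ ^ α) * M' + M * (C' * ‖x - y‖ ^ α) := by
        gcongr
        exacts [hfC x y, hM' x, hM y, hgC x y]
    _ = _ := by ring

lemma BH.const {d : ℕ} {α : ℝ} (a : ℝ) : BH α (fun _ : Euc d => a) :=
  ⟨⟨|a|, fun _ => le_rfl⟩, 0, le_rfl, fun x y => by simp⟩

lemma BH.continuous {d : ℕ} {α : ℝ} (hα : 0 < α) {f : Euc d → ℝ} (hf : BH α f) :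
    Continuous f := by
  obtain ⟨-, C, hC, hfC⟩ := hf
  rw [continuous_iff_continuousAt]
  intro x
  rw [ContinuousAt, tendsto_iff_dist_tendsto_zero]
  refine squeeze_zero (fun _ => dist_nonneg) (g := fun y => C * ‖y - x‖ ^ α)
    (fun y => by rw [Real.dist_eq]; exact hfC y x) ?_
  have : Continuous fun y : Euc d => C * ‖y - x‖ ^ α :=
    continuous_const.mul ((continuous_id.sub continuous_const).norm.rpow_const
      (fun _ => Or.inr hα.le))
  have h := this.tendsto x
  simpa [Real.zero_rpow hα.ne'] using h

lemma holder_of_lip {α : ℝ} (hα0 : 0 < α) (hα1 : α ≤ 1) {t a M L : ℝ} (ht : 0 ≤ t)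
    (hM : 0 ≤ M) (hL : 0 ≤ L) (h1 : a ≤ M) (h2 : a ≤ L * t) : a ≤ (M + L) * t ^ α := by
  rcases le_total t 1 with h | h
  · have : t ≤ t ^ α := by
      have := Real.rpow_le_rpow_of_exponent_ge_of_imp ht h hα1 (fun _ h => by norm_num at h)
      simpa using this
    have h3 : 0 ≤ t ^ α := by positivity
    nlinarith
  · have : 1 ≤ t ^ α := Real.one_le_rpow h hα0.le
    nlinarith

lemma BH.of_lip {d : ℕ} {α : ℝ} (hα0 : 0 < α) (hα1 : α ≤ 1) {f : Euc d → ℝ} {M L : ℝ}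
    (hL : 0 ≤ L) (hM : ∀ x, |f x| ≤ M) (hf : ∀ x y, |f x - f y| ≤ L * ‖x - y‖) : BH α f := by
  have hM0 : 0 ≤ M := (abs_nonneg _).trans (hM 0)
  refine ⟨⟨M, hM⟩, 2 * M + L, by positivity, fun x y => ?_⟩
  refine holder_of_lip hα0 hα1 (norm_nonneg _) (by positivity) hL ?_ (hf x y)
  refine (abs_sub _ _).trans ?_
  linarith [hM x, hM y]

lemma integral_dil {d : ℕ} (y₀ : Euc d) {s : ℝ} (hs : 0 < s) :
    ∃ k : ℝ, 0 < k ∧ ∀ F : Euc d → ℝ, ∫ x, F (y₀ + s • (x - y₀)) = k * ∫ x, F x := by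
  refine ⟨|(s ^ Module.finrank ℝ (Euc d))⁻¹|, by positivity, fun F => ?_⟩
  rw [integral_sub_right_eq_self (fun z => F (y₀ + s • z)) y₀,
    Measure.integral_comp_smul volume (fun z => F (y₀ + z)) s, integral_add_left_eq_self,
    smul_eq_mul]

lemma form_dil {d : ℕ} {α : ℝ} (hα0 : 0 < α) (y₀ : Euc d) {r : ℝ} (hr : 0 < r) {V : Euc d → ℝ}
    (hVH : BH α V) {lam : ℝ} (hlam : lam < lambda0 (ball y₀ r) V) :
    ∃ s > 1, ∃ c > 0, ∀ φ : Euc d → ℝ, ContDiff ℝ 1 φ → HasCompactSupport φ →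
      tsupport φ ⊆ ball y₀ (s * r) →
      c * ∫ x, φ x ^ 2 ≤ ∫ x, (‖fderiv ℝ φ x‖ ^ 2 + (V x - lam) * φ x ^ 2) := by
  have hV := hVH.continuous hα0
  obtain ⟨⟨K, hK⟩, C, hC, hVC⟩ := hVH
  set L := lambda0 (ball y₀ r) V with hL
  set Br : ℝ → ℝ := fun s => (L - C * ((s - 1) * r) ^ α) - s ^ 2 * lam - (s ^ 2 - 1) * K with hBr
  have hBc : ContinuousAt Br 1 := by
    have : ContinuousAt (fun s : ℝ => ((s - 1) * r) ^ α) 1 :=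
      ContinuousAt.rpow_const (by fun_prop) (Or.inr hα0.le)
    fun_prop
  have hB1 : 0 < Br 1 := by
    simp [hBr, Real.zero_rpow hα0.ne']; linarith
  obtain ⟨s, hs1, hs⟩ : ∃ s > 1, 0 < Br s := by
    have h1 : ∀ᶠ s in nhdsWithin (1:ℝ) (Set.Ioi 1), 0 < Br s :=
      (hBc.eventually (lt_mem_nhds hB1)).filter_mono nhdsWithin_le_nhds
    obtain ⟨s, h2, h3⟩ := (h1.and self_mem_nhdsWithin).exists
    exact ⟨s, h3, h2⟩
  have hs0 : 0 < s := by linarith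
  refine ⟨s, hs1, Br s / s ^ 2, by positivity, fun φ hφ hc hsupp => ?_⟩
  set T : Euc d → Euc d := fun x => y₀ + s • (x - y₀) with hT
  have hTc : ContDiff ℝ 1 T := by rw [hT]; fun_prop
  set φs : Euc d → ℝ := fun x => φ (T x) with hφs
  have hφs1 : ContDiff ℝ 1 φs := hφ.comp hTc
  have hTinv : ∀ x, y₀ + s⁻¹ • (T x - y₀) = x := by
    intro x; simp [hT, smul_smul, inv_mul_cancel₀ hs0.ne']
  have hsub : tsupport φs ⊆ T ⁻¹' (tsupport φ) :=
    tsupport_comp_subset_preimage φ hTc.continuous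
  obtain ⟨R', hR', hsR'⟩ := exists_lt_subset_ball (isClosed_tsupport φ) hsupp
  have hφss : tsupport φs ⊆ ball y₀ r := by
    intro x hx
    have h1 := hsupp (hsub hx)
    rw [mem_ball, dist_eq_norm] at h1 ⊢
    simp only [hT, add_sub_cancel_left, norm_smul, Real.norm_eq_abs, abs_of_pos hs0] at h1
    exact lt_of_mul_lt_mul_left h1 hs0.le
  have hφsc : HasCompactSupport φs :=
    (isCompact_closedBall y₀ r).of_isClosed_subset (isClosed_tsupport _)
      (hφss.trans ball_subset_closedBall)
  have hray := rayleigh_C1 isOpen_ball hV hK hφs1 hφsc hφss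
  rw [← hL] at hray
  have hder : ∀ x, ‖fderiv ℝ φs x‖ ^ 2 = s ^ 2 * ‖fderiv ℝ φ (T x)‖ ^ 2 := by
    intro x
    have h1 : HasFDerivAt T (s • ContinuousLinearMap.id ℝ (Euc d)) x :=
      (((hasFDerivAt_id x).sub_const y₀).const_smul s).const_add y₀
    have h2 := ((hφ.differentiable (by norm_num) (T x)).hasFDerivAt).comp x h1
    have h3 : fderiv ℝ φs x = _ := h2.fderiv
    rw [h3]
    simp [norm_smul, mul_pow]
  obtain ⟨k, hk, hIntg⟩ := integral_dil y₀ hs0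
  have e1 : ∫ x, φs x ^ 2 = k * ∫ x, φ x ^ 2 := hIntg (fun z => φ z ^ 2)
  have e2 : ∫ x, (‖fderiv ℝ φs x‖ ^ 2 + V x * φs x ^ 2) = k * ∫ x,
      (s ^ 2 * ‖fderiv ℝ φ x‖ ^ 2 + V (y₀ + s⁻¹ • (x - y₀)) * φ x ^ 2) := by
    rw [← hIntg]
    congr 1; funext x
    rw [hder]
    have := hTinv x
    simp only [hT] at this
    rw [this]
  rw [e1, e2, mul_left_comm] at hray
  have hray2 := le_of_mul_le_mul_left hray hk
  have c1 : Continuous (fderiv ℝ φ) := hφ.continuous_fderiv (by norm_num)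
  have c2 := hφ.continuous
  have j1 : Integrable fun x => ‖fderiv ℝ φ x‖ ^ 2 := integrable_of_tsupp (by fun_prop) hc
    (fun x hx => by simp [fderiv_of_notMem_tsupport ℝ hx])
  have j2 : Integrable fun x => V x * φ x ^ 2 := integrable_of_tsupp (by fun_prop) hc
    (fun x hx => by simp [image_eq_zero_of_notMem_tsupport hx])
  have j3 : Integrable fun x => φ x ^ 2 := integrable_of_tsupp (by fun_prop) hc
    (fun x hx => by simp [image_eq_zero_of_notMem_tsupport hx])
  have j4 : Integrable fun x => s ^ 2 * ‖fderiv ℝ φ x‖ ^ 2 + V (y₀ + s⁻¹ • (x - y₀)) * φ x ^ 2 :=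
    integrable_of_tsupp (by fun_prop) hc
      (fun x hx => by simp [image_eq_zero_of_notMem_tsupport hx, fderiv_of_notMem_tsupport ℝ hx])
  have hJ : ∫ x, V x * φ x ^ 2 ≥ - (K * ∫ x, φ x ^ 2) := by
    rw [← integral_const_mul, ← integral_neg]
    refine integral_mono (j3.const_mul K).neg j2 fun x => ?_
    have := (abs_le.1 (hK x)).1
    simp only
    nlinarith [sq_nonneg (φ x)]
  have j5 : Integrable fun x => s ^ 2 * ‖fderiv ℝ φ x‖ ^ 2 + V x * φ x ^ 2 :=
    (j1.const_mul _).add j2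
  have j6 : Integrable fun x => ‖fderiv ℝ φ x‖ ^ 2 + V x * φ x ^ 2 := j1.add j2
  have hF : ∫ x, (s ^ 2 * ‖fderiv ℝ φ x‖ ^ 2 + V (y₀ + s⁻¹ • (x - y₀)) * φ x ^ 2)
      ≤ s ^ 2 * (∫ x, ‖fderiv ℝ φ x‖ ^ 2) + (∫ x, V x * φ x ^ 2)
        + C * ((s - 1) * r) ^ α * ∫ x, φ x ^ 2 := by
    rw [← integral_const_mul, ← integral_const_mul, ← integral_add (j1.const_mul _) j2,
      ← integral_add j5 (j3.const_mul _)]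
    refine integral_mono j4 (j5.add (j3.const_mul _)) fun x => ?_
    simp only
    by_cases hx : x ∈ tsupport φ
    · have h1 := hsupp hx
      rw [mem_ball, dist_eq_norm] at h1
      have h2 := hVC (y₀ + s⁻¹ • (x - y₀)) x
      have h3 : ‖y₀ + s⁻¹ • (x - y₀) - x‖ ≤ (s - 1) * r := by
        have : y₀ + s⁻¹ • (x - y₀) - x = (s⁻¹ - 1) • (x - y₀) := by
          rw [sub_smul, one_smul]; abel
        rw [this, norm_smul, Real.norm_eq_abs, abs_sub_comm, abs_of_nonneg
          (by rw [sub_nonneg]; exact inv_le_one_of_one_le₀ hs1.le)]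
        have h5 : 0 ≤ 1 - s⁻¹ := by rw [sub_nonneg]; exact inv_le_one_of_one_le₀ hs1.le
        calc (1 - s⁻¹) * ‖x - y₀‖ ≤ (1 - s⁻¹) * (s * r) := by gcongr
          _ = _ := by field_simp
      have h4 : ‖y₀ + s⁻¹ • (x - y₀) - x‖ ^ α ≤ ((s - 1) * r) ^ α :=
        Real.rpow_le_rpow (norm_nonneg _) h3 hα0.le
      have h6 : V (y₀ + s⁻¹ • (x - y₀)) - V x ≤ C * ((s - 1) * r) ^ α :=
        (le_abs_self _).trans (h2.trans (by gcongr))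
      nlinarith [sq_nonneg (φ x)]
    · simp [image_eq_zero_of_notMem_tsupport hx, fderiv_of_notMem_tsupport ℝ hx]
  have hsplit : ∫ x, (‖fderiv ℝ φ x‖ ^ 2 + (V x - lam) * φ x ^ 2)
      = (∫ x, ‖fderiv ℝ φ x‖ ^ 2) + (∫ x, V x * φ x ^ 2) - lam * ∫ x, φ x ^ 2 := by
    rw [← integral_const_mul, ← integral_add j1 j2, ← integral_sub j6 (j3.const_mul _)]
    congr 1; funext x; ring
  rw [hsplit, div_mul_eq_mul_div, div_le_iff₀ (by positivity)]
  set I := ∫ x, φ x ^ 2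
  set D := ∫ x, ‖fderiv ℝ φ x‖ ^ 2
  set J := ∫ x, V x * φ x ^ 2
  have hs2 : 0 ≤ s ^ 2 - 1 := by nlinarith
  simp only [hBr]
  have h7 := mul_le_mul_of_nonneg_left hJ hs2
  nlinarith

end Part5

section Part6

open MeasureTheory Metric Filter

lemma cutoff_scalar {η A X : ℝ} (h0 : 0 ≤ η) (h1 : η ≤ 1) :
    ((1 - η ^ 2) * A + 2 * η * X) ^ 2 ≤ A ^ 2 + 8 * X ^ 2 := by
  have hχ : 0 ≤ 1 - η ^ 2 := by nlinarith
  have hη : η ^ 2 ≤ 1 := by nlinarith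
  have e1 : 0 ≤ (1 - η ^ 2) * (η * A - 2 * X) ^ 2 := mul_nonneg hχ (sq_nonneg _)
  have e2 : 0 ≤ η ^ 2 * A ^ 2 := by positivity
  have e3 : 0 ≤ (1 - η ^ 2) * X ^ 2 := by positivity
  have e4 : 0 ≤ η ^ 2 * X ^ 2 := by positivity
  nlinarith

set_option maxHeartbeats 800000 in
lemma exists_global_form {d : ℕ} {α : ℝ} (hα0 : 0 < α) (hα1 : α ≤ 1) (y₀ : Euc d) {r : ℝ}
    (hr : 0 < r) {V : Euc d → ℝ}
    (hVH : BH α V) {lam : ℝ} (hlam : lam < lambda0 (ball y₀ r) V) :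
    ∃ W : Euc d → ℝ, BH α W ∧ (∀ x ∈ closedBall y₀ r, W x = V x - lam) ∧
      ∃ c > 0, ∀ φ : Euc d → ℝ, ContDiff ℝ 1 φ → HasCompactSupport φ →
      c * ∫ x, φ x ^ 2 ≤ ∫ x, (‖fderiv ℝ φ x‖ ^ 2 + W x * φ x ^ 2) := by
  obtain ⟨s, hs, c, hc, hform⟩ := form_dil hα0 y₀ hr hVH hlam
  have hV := hVH.continuous hα0
  obtain ⟨K, hK⟩ := hVH.1
  have hK0 : 0 ≤ K := (abs_nonneg _).trans (hK 0)
  set δ := (s - 1) * r / 3 with hδ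
  have hδ0 : 0 < δ := by have : 0 < s - 1 := by linarith
                         positivity
  have hsr : s * r = r + 3 * δ := by rw [hδ]; ring
  let b : ContDiffBump y₀ := ⟨r + δ, r + 2 * δ, by positivity, by linarith⟩
  have hb1 : ContDiff ℝ 1 b := b.contDiff
  have cb : Continuous (fderiv ℝ b) := hb1.continuous_fderiv (by norm_num)
  obtain ⟨B, hB⟩ := cb.bounded_above_of_compact_support (b.hasCompactSupport.fderiv (𝕜 := ℝ))
  have hB0 : 0 ≤ B := (norm_nonneg _).trans (hB 0)
  set ρ : Euc d → ℝ := fun x => min 1 (max 0 (‖x - y₀‖ - r)) with hρ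
  have hρ0 : ∀ x, 0 ≤ ρ x := fun x => le_min zero_le_one (le_max_left _ _)
  have hρH : BH α ρ := by
    refine BH.of_lip hα0 hα1 (M := 1) (L := 1) zero_le_one ?_ ?_
    · intro x; rw [abs_of_nonneg (hρ0 x)]; exact min_le_left _ _
    · intro x y
      have h1 : |‖x - y₀‖ - r - (‖y - y₀‖ - r)| ≤ ‖x - y‖ := by
        have := abs_norm_sub_norm_le (x - y₀) (y - y₀)
        simpa using this
      have h2 := abs_max_sub_max_le_abs (‖x - y₀‖ - r) (‖y - y₀‖ - r) 0
      have h3 := abs_min_sub_min_le_max 1 (max 0 (‖x - y₀‖ - r)) 1 (max 0 (‖y - y₀‖ - r))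
      rw [sub_self, abs_zero,
        max_eq_right (abs_nonneg (max 0 (‖x - y₀‖ - r) - max 0 (‖y - y₀‖ - r)))] at h3
      rw [max_comm _ (0:ℝ), max_comm _ (0:ℝ)] at h2
      rw [one_mul]
      exact h3.trans (h2.trans h1)
  set N := (2 * (K + |lam|) + 8 * B ^ 2 + c) / min 1 δ with hN
  have hmin : 0 < min 1 δ := lt_min one_pos hδ0
  have hN0 : 0 ≤ N := by positivity
  set W : Euc d → ℝ := fun x => (V x + (-lam)) + N * ρ x with hW
  have hWH : BH α W := (hVH.add (BH.const _)).add ((BH.const N).mul hρH)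
  have hWc := hWH.continuous hα0
  refine ⟨W, hWH, ?_, c, hc, ?_⟩
  · intro x hx
    rw [mem_closedBall, dist_eq_norm] at hx
    have : ρ x = 0 := by
      simp only [hρ]; rw [max_eq_left (by linarith)]; simp
    simp only [hW, this]; ring
  · intro φ hφ hφc
    set χ : Euc d → ℝ := fun x => b x * (2 - b x) with hχ
    have hχ1 : ContDiff ℝ 1 χ := hb1.mul (contDiff_const.sub hb1)
    set ψ : Euc d → ℝ := fun x => χ x * φ x with hψ
    have hψ1 : ContDiff ℝ 1 ψ := hχ1.mul hφ
    have hψs : tsupport ψ ⊆ closedBall y₀ (r + 2 * δ) := by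
      have : tsupport b = closedBall y₀ (r + 2 * δ) := b.tsupport_eq
      rw [← this]
      exact closure_mono (fun x hx h => hx (by simp [hψ, hχ, h]))
    have hψc : HasCompactSupport ψ :=
      (isCompact_closedBall y₀ _).of_isClosed_subset (isClosed_tsupport _) hψs
    have hψb : tsupport ψ ⊆ ball y₀ (s * r) :=
      hψs.trans (closedBall_subset_ball (by linarith))
    have hmain := hform ψ hψ1 hψc hψb
    have c1 : Continuous (fderiv ℝ φ) := hφ.continuous_fderiv (by norm_num)
    have c2 := hφ.continuous
    have c3 : Continuous (fderiv ℝ ψ) := hψ1.continuous_fderiv (by norm_num)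
    have c4 := hψ1.continuous
    have j0 : Integrable fun x => φ x ^ 2 := integrable_of_tsupp (by fun_prop) hφc
      (fun x hx => by simp [image_eq_zero_of_notMem_tsupport hx])
    have j1 : Integrable fun x => ‖fderiv ℝ φ x‖ ^ 2 + W x * φ x ^ 2 :=
      integrable_of_tsupp (by fun_prop) hφc (fun x hx => by
        simp [image_eq_zero_of_notMem_tsupport hx, fderiv_of_notMem_tsupport ℝ hx])
    have j2 : Integrable fun x => ψ x ^ 2 := integrable_of_tsupp (by fun_prop) hψc
      (fun x hx => by simp [image_eq_zero_of_notMem_tsupport hx])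
    have j3 : Integrable fun x => ‖fderiv ℝ ψ x‖ ^ 2 + (V x - lam) * ψ x ^ 2 :=
      integrable_of_tsupp (by fun_prop) hψc (fun x hx => by
        simp [image_eq_zero_of_notMem_tsupport hx, fderiv_of_notMem_tsupport ℝ hx])
    have hpt : ∀ x, ‖fderiv ℝ ψ x‖ ^ 2 + (V x - lam) * ψ x ^ 2 + c * φ x ^ 2 ≤
        ‖fderiv ℝ φ x‖ ^ 2 + W x * φ x ^ 2 + c * ψ x ^ 2 := by
      intro x
      have hbx0 : 0 ≤ b x := b.nonneg
      have hbx1 : b x ≤ 1 := b.le_one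
      set η := 1 - b x with hη
      have hη0 : 0 ≤ η := by linarith
      have hη1 : η ≤ 1 := by linarith
      have hχx : χ x = 1 - η ^ 2 := by simp only [hχ, hη]; ring
      have hχ0 : 0 ≤ 1 - η ^ 2 := by nlinarith
      have hd : fderiv ℝ ψ x = χ x • fderiv ℝ φ x + φ x • ((2 * η) • fderiv ℝ b x) := by
        have h1 := (hb1.differentiable (by norm_num) x).hasFDerivAt
        have h2 := (hφ.differentiable (by norm_num) x).hasFDerivAt
        have h3 := (h1.mul ((hasFDerivAt_const (2:ℝ) x).sub h1)).mul h2
        have : fderiv ℝ ψ x = _ := h3.fderiv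
        rw [this]
        ext v
        simp [hχ, hη]; ring
      have hnorm : ‖fderiv ℝ ψ x‖ ≤ (1 - η ^ 2) * ‖fderiv ℝ φ x‖ + 2 * η * (|φ x| * B) := by
        rw [hd]
        refine (norm_add_le _ _).trans ?_
        rw [norm_smul, norm_smul, norm_smul, hχx, Real.norm_eq_abs, Real.norm_eq_abs,
          Real.norm_eq_abs, abs_of_nonneg hχ0, abs_of_nonneg (by positivity : 0 ≤ 2 * η)]
        have := hB x
        have h4 : |φ x| * (2 * η * ‖fderiv ℝ b x‖) ≤ |φ x| * (2 * η * B) := by gcongr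
        linarith
      have hψx : ψ x = (1 - η ^ 2) * φ x := by simp only [hψ]; rw [hχx]
      have hφ2 := sq_nonneg (φ x)
      have hVl : |V x - lam| ≤ K + |lam| := (abs_sub _ _).trans (by linarith [hK x])
      have hVl' := abs_le.1 hVl
      by_cases hx : x ∈ closedBall y₀ (r + δ)
      · have hb : b x = 1 := b.one_of_mem_closedBall hx
        have hη' : η = 0 := by rw [hη, hb]; ring
        rw [hη'] at hnorm hψx
        simp only [ne_eq, OfNat.ofNat_ne_zero, not_false_eq_true, zero_pow, sub_zero, one_mul,
          mul_zero, zero_mul, add_zero] at hnorm hψx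
        have h5 : ‖fderiv ℝ ψ x‖ ^ 2 ≤ ‖fderiv ℝ φ x‖ ^ 2 := by gcongr
        have h6 : 0 ≤ N * ρ x * φ x ^ 2 := by have := hρ0 x; positivity
        rw [hψx]; simp only [hW]; linarith
      · have h5 : ‖fderiv ℝ ψ x‖ ^ 2 ≤ ‖fderiv ℝ φ x‖ ^ 2 + 8 * (|φ x| * B) ^ 2 :=
          (by gcongr : ‖fderiv ℝ ψ x‖ ^ 2 ≤ _ ^ 2).trans (cutoff_scalar hη0 hη1)
        rw [mul_pow, sq_abs] at h5
        rw [mem_closedBall, dist_eq_norm, not_le] at hx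
        have hρx : min 1 δ ≤ ρ x := by
          simp only [hρ]
          exact min_le_min_left _ (le_max_of_le_right (by linarith))
        have hNρ : 2 * (K + |lam|) + 8 * B ^ 2 + c ≤ N * ρ x := by
          calc _ = N * min 1 δ := by rw [hN]; field_simp
            _ ≤ _ := by gcongr
        have hψ2 : ψ x ^ 2 = (1 - η ^ 2) ^ 2 * φ x ^ 2 := by rw [hψx]; ring
        have hq1 : (1 - η ^ 2) ^ 2 ≤ 1 := by nlinarith
        have hq0 : 0 ≤ (1 - η ^ 2) ^ 2 := sq_nonneg _
        rw [hψ2]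
        set q := (1 - η ^ 2) ^ 2
        simp only [hW]
        have e1 : (V x - lam) * q ≤ K + |lam| := by
          calc (V x - lam) * q ≤ (K + |lam|) * q := mul_le_mul_of_nonneg_right hVl'.2 hq0
            _ ≤ (K + |lam|) * 1 := mul_le_mul_of_nonneg_left hq1 (by positivity)
            _ = _ := mul_one _
        have e2 : 0 ≤ c * q := by positivity
        have e3 : (V x - lam) * q + c + 8 * B ^ 2 ≤ V x + -lam + N * ρ x + c * q := by
          linarith [hVl'.1, hNρ, e1, e2]
        have e4 := mul_le_mul_of_nonneg_right e3 hφ2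
        rw [add_mul, add_mul, add_mul _ (c * q)] at e4
        rw [show (V x - lam) * (q * φ x ^ 2) = (V x - lam) * q * φ x ^ 2 by ring,
          show c * (q * φ x ^ 2) = c * q * φ x ^ 2 by ring]
        rw [show φ x ^ 2 * B ^ 2 = B ^ 2 * φ x ^ 2 by ring] at h5
        linarith only [e4, h5]
    have h1 := integral_mono (j3.add (j0.const_mul c)) (j1.add (j2.const_mul c)) hpt
    simp only [Pi.add_apply] at h1
    rw [integral_add j3 (j0.const_mul c), integral_add j1 (j2.const_mul c), integral_const_mul,
      integral_const_mul] at h1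
    linarith

/-- Radial retraction onto the closed ball. -/
noncomputable def retr {d : ℕ} (y₀ : Euc d) (r : ℝ) (x : Euc d) : Euc d :=
  y₀ + (r / max r ‖x - y₀‖) • (x - y₀)

lemma retr_mem {d : ℕ} (y₀ : Euc d) {r : ℝ} (hr : 0 < r) (x : Euc d) :
    retr y₀ r x ∈ closedBall y₀ r := by
  have hm : 0 < max r ‖x - y₀‖ := lt_max_of_lt_left hr
  rw [mem_closedBall, dist_eq_norm, retr, add_sub_cancel_left, norm_smul, Real.norm_eq_abs,
    abs_of_nonneg (by positivity), div_mul_eq_mul_div, div_le_iff₀ hm]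
  gcongr
  exact le_max_right _ _

lemma retr_eq {d : ℕ} (y₀ : Euc d) {r : ℝ} (hr : 0 < r) {x : Euc d} (hx : x ∈ closedBall y₀ r) :
    retr y₀ r x = x := by
  rw [mem_closedBall, dist_eq_norm] at hx
  rw [retr, max_eq_left hx, div_self hr.ne']
  simp

lemma retr_lip {d : ℕ} (y₀ : Euc d) {r : ℝ} (hr : 0 < r) (x y : Euc d) :
    ‖retr y₀ r x - retr y₀ r y‖ ≤ 2 * ‖x - y‖ := by
  set a := x - y₀ with ha
  set b := y - y₀ with hb
  have hab : x - y = a - b := by rw [ha, hb]; abel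
  set p := max r ‖a‖ with hp
  set q := max r ‖b‖ with hq
  have hp0 : 0 < p := lt_max_of_lt_left hr
  have hq0 : 0 < q := lt_max_of_lt_left hr
  have hpr : r ≤ p := le_max_left _ _
  have hqb : ‖b‖ ≤ q := le_max_right _ _
  have e : retr y₀ r x - retr y₀ r y = (r / p) • (a - b) + (r / p - r / q) • b := by
    have e1 : retr y₀ r x = y₀ + (r / p) • a := rfl
    have e2 : retr y₀ r y = y₀ + (r / q) • b := rfl
    rw [e1, e2]
    clear_value a b p q
    module
  have hpq : |q - p| ≤ ‖a - b‖ := by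
    have h2 := abs_max_sub_max_le_abs ‖b‖ ‖a‖ r
    rw [max_comm _ r, max_comm _ r] at h2
    refine h2.trans ((abs_norm_sub_norm_le b a).trans ?_)
    rw [norm_sub_rev]
  rw [e, hab]
  refine (norm_add_le _ _).trans ?_
  rw [norm_smul, norm_smul, Real.norm_eq_abs, Real.norm_eq_abs, abs_of_nonneg (by positivity)]
  have h1 : r / p ≤ 1 := (div_le_one hp0).2 hpr
  have h2 : |r / p - r / q| * ‖b‖ ≤ ‖a - b‖ := by
    have : r / p - r / q = (r / p) * ((q - p) / q) := by field_simp
    rw [this, abs_mul, abs_of_nonneg (by positivity : 0 ≤ r / p), abs_div, abs_of_pos hq0]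
    calc r / p * (|q - p| / q) * ‖b‖ ≤ 1 * (|q - p| / q) * q := by gcongr
      _ = |q - p| := by field_simp
      _ ≤ _ := hpq
  have h3 : r / p * ‖a - b‖ ≤ 1 * ‖a - b‖ := by gcongr
  linarith

lemma exists_ext {d : ℕ} {α C : ℝ} (hα0 : 0 < α) (hC : 0 < C) (y₀ : Euc d) {r : ℝ} (hr : 0 < r)
    {V : Euc d → ℝ} (hV : ∀ x ∈ closedBall y₀ r, ∀ x' ∈ closedBall y₀ r,
      |V x - V x'| ≤ C * ‖x - x'‖ ^ α) :
    ∃ V' : Euc d → ℝ, BH α V' ∧ ∀ x ∈ closedBall y₀ r, V' x = V x := by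
  refine ⟨fun x => V (retr y₀ r x), ⟨⟨|V y₀| + C * r ^ α, fun x => ?_⟩, C * 2 ^ α, by positivity,
    fun x y => ?_⟩, fun x hx => by
      show V (retr y₀ r x) = V x
      rw [retr_eq y₀ hr hx]⟩
  · have hm := retr_mem y₀ hr x
    have h1 := hV _ hm y₀ (by simp [hr.le])
    have h2 : ‖retr y₀ r x - y₀‖ ^ α ≤ r ^ α := by
      refine Real.rpow_le_rpow (norm_nonneg _) ?_ hα0.le
      rwa [mem_closedBall, dist_eq_norm] at hm
    have h3 := abs_add_le (V (retr y₀ r x) - V y₀) (V y₀)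
    rw [sub_add_cancel] at h3
    have : C * ‖retr y₀ r x - y₀‖ ^ α ≤ C * r ^ α := by gcongr
    linarith
  · refine (hV _ (retr_mem y₀ hr x) _ (retr_mem y₀ hr y)).trans ?_
    rw [mul_assoc, ← Real.mul_rpow (by norm_num) (norm_nonneg _)]
    gcongr
    exact retr_lip y₀ hr x y

end Part6

section Part7

open MeasureTheory Metric Filter

noncomputable instance instD1 {d : ℕ} : NormedAddCommGroup (Euc d →L[ℝ] ℝ) :=
  ContinuousLinearMap.toNormedAddCommGroup

noncomputable instance instD1s {d : ℕ} : NormedSpace ℝ (Euc d →L[ℝ] ℝ) :=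
  ContinuousLinearMap.toNormedSpace

noncomputable instance instD2 {d : ℕ} : NormedAddCommGroup (Euc d →L[ℝ] Euc d →L[ℝ] ℝ) :=
  ContinuousLinearMap.toNormedAddCommGroup

noncomputable instance instD2s {d : ℕ} : NormedSpace ℝ (Euc d →L[ℝ] Euc d →L[ℝ] ℝ) :=
  ContinuousLinearMap.toNormedSpace

instance instD2c {d : ℕ} : ContinuousAdd (Euc d →L[ℝ] Euc d →L[ℝ] ℝ) :=
  IsTopologicalAddGroup.toContinuousAdd

noncomputable instance instD2a {d : ℕ} : AddCommGroup (Euc d →L[ℝ] Euc d →L[ℝ] ℝ) :=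
  ContinuousLinearMap.addCommGroup

noncomputable instance instD2b {d : ℕ} : Add (Euc d →L[ℝ] Euc d →L[ℝ] ℝ) :=
  ContinuousLinearMap.add

set_option synthInstance.maxHeartbeats 200000

lemma gauss_integrable (d : ℕ) {b : ℝ} (hb : 0 < b) :
    Integrable fun z : Euc d => Real.exp (-b * ‖z‖ ^ 2) := by
  by_contra h
  have h1 := GaussianFourier.integral_rexp_neg_mul_sq_norm (V := Euc d) hb
  rw [integral_undef h] at h1
  have : 0 < (Real.pi / b) ^ (Module.finrank ℝ (Euc d) / 2 : ℝ) := by positivity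
  linarith

/-- Normalisation constant of the Gaussian. -/
noncomputable def gc (d : ℕ) : ℝ := (∫ z : Euc d, Real.exp (-(1 / 4) * ‖z‖ ^ 2))⁻¹

lemma gc_pos (d : ℕ) : 0 < gc d := by
  rw [gc, GaussianFourier.integral_rexp_neg_mul_sq_norm (by norm_num)]
  positivity

/-- The Gaussian. -/
noncomputable def gam {d : ℕ} (z : Euc d) : ℝ := gc d * Real.exp (-(1 / 4) * ‖z‖ ^ 2)

lemma gam_pos {d : ℕ} (z : Euc d) : 0 < gam z := mul_pos (gc_pos d) (Real.exp_pos _)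

lemma integral_gam (d : ℕ) : ∫ z : Euc d, gam z = 1 := by
  simp only [gam]
  rw [integral_const_mul]
  exact inv_mul_cancel₀ (fun h => (gc_pos d).ne' (by rw [gc, h, inv_zero]))

/-- The Riesz map. -/
noncomputable def rj {d : ℕ} : Euc d →L[ℝ] (Euc d →L[ℝ] ℝ) :=
  LinearMap.toContinuousLinearMap
    { toFun := fun z => innerSL ℝ z
      map_add' := fun x y => by simp
      map_smul' := fun c x => by simp }

lemma rj_apply {d : ℕ} (z v : Euc d) : rj z v = inner ℝ z v := rfl

lemma rj_norm {d : ℕ} (z : Euc d) : ‖rj z‖ = ‖z‖ := innerSL_apply_norm ℝ z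

lemma rj_opNorm {d : ℕ} : ‖(rj : Euc d →L[ℝ] (Euc d →L[ℝ] ℝ))‖ ≤ 1 :=
  ContinuousLinearMap.opNorm_le_bound _ zero_le_one fun z => by rw [rj_norm, one_mul]

/-- First derivative of the Gaussian. -/
noncomputable def gam1 {d : ℕ} (z : Euc d) : Euc d →L[ℝ] ℝ := (-(1 / 2) * gam z) • rj z

/-- Second derivative of the Gaussian. -/
noncomputable def gam2 {d : ℕ} (z : Euc d) : Euc d →L[ℝ] (Euc d →L[ℝ] ℝ) :=
  (-(1 / 2) * gam z) • rj + ((-(1 / 2) : ℝ) • gam1 z).smulRight (rj z)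

lemma hasFDerivAt_gam {d : ℕ} (z : Euc d) : HasFDerivAt gam (gam1 z) z := by
  have h1 := (hasStrictFDerivAt_norm_sq z).hasFDerivAt
  have h2 := ((h1.const_mul (-(1 / 4))).exp).const_mul (gc d)
  refine h2.congr_fderiv ?_
  ext v
  simp [gam1, gam, rj_apply]
  ring

lemma hasFDerivAt_gam1 {d : ℕ} (z : Euc d) : HasFDerivAt gam1 (gam2 z) z := by
  have h1 := ((hasFDerivAt_gam z).const_mul (-(1 / 2))).smul (rj.hasFDerivAt (x := z))
  have h2 : (fun y : Euc d => -(1 / 2) * gam y) • ⇑(rj : Euc d →L[ℝ] _) = gam1 := rfl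
  rw [h2] at h1
  exact h1

lemma continuous_gam {d : ℕ} : Continuous (gam : Euc d → ℝ) :=
  continuous_iff_continuousAt.2 fun z => (hasFDerivAt_gam z).continuousAt

lemma continuous_gam1 {d : ℕ} : Continuous (gam1 : Euc d → _) :=
  continuous_iff_continuousAt.2 fun z => (hasFDerivAt_gam1 z).continuousAt

lemma continuous_gam2 {d : ℕ} : Continuous (gam2 : Euc d → _) := by
  have h1 : Continuous (gam : Euc d → ℝ) := continuous_gam
  have h2 : Continuous (gam1 : Euc d → _) := continuous_gam1
  have h3 : Continuous fun z : Euc d => rj z := rj.continuous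
  have : Continuous fun z : Euc d => ((-(1 / 2) : ℝ) • gam1 z).smulRight (rj z) := by
    have h4 : Continuous fun z : Euc d => (-(1 / 2) : ℝ) • gam1 z := by fun_prop
    exact (ContinuousLinearMap.smulRightL ℝ (Euc d) (Euc d →L[ℝ] ℝ)).continuous₂.comp
      (h4.prodMk h3)
  exact ((continuous_const.mul h1).smul continuous_const).add this

lemma trace_gam2 {d : ℕ} (z : Euc d) :
    ∑ i, gam2 z (eb i) (eb i) = (‖z‖ ^ 2 / 4 - d / 2) * gam z := by
  have h : ∀ i, gam2 z (eb i) (eb i) = -(1 / 2) * gam z + gam z * (1 / 4) * (z i) ^ 2 := by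
    intro i
    have h1 : inner ℝ z (EuclideanSpace.single i 1) = z i := by
      rw [EuclideanSpace.inner_single_right]; simp
    simp [gam2, gam1, rj_apply, eb]
    rw [h1]
    ring
  simp only [h]
  rw [Finset.sum_add_distrib, ← Finset.mul_sum, EuclideanSpace.norm_sq_eq]
  rw [← Finset.mul_sum]
  simp
  ring

lemma gam_bound {d : ℕ} (z : Euc d) :
    (1 + ‖z‖ ^ 2) ^ 2 * gam z ≤ 256 * gc d * Real.exp (-(1 / 8) * ‖z‖ ^ 2) := by
  have h1 : 1 + ‖z‖ ^ 2 ≤ 16 * Real.exp (‖z‖ ^ 2 / 16) := by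
    have := Real.add_one_le_exp (‖z‖ ^ 2 / 16)
    linarith
  have h2 : (1 + ‖z‖ ^ 2) ^ 2 ≤ (16 * Real.exp (‖z‖ ^ 2 / 16)) ^ 2 := by gcongr
  have h3 := mul_le_mul_of_nonneg_right h2 (gam_pos z).le
  refine h3.trans (le_of_eq ?_)
  have : Real.exp (-(1 / 8) * ‖z‖ ^ 2) =
      Real.exp (‖z‖ ^ 2 / 16) ^ 2 * Real.exp (-(1 / 4) * ‖z‖ ^ 2) := by
    rw [sq (Real.exp _), ← Real.exp_add, ← Real.exp_add]; congr 1; ring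
  rw [this, gam]; ring

lemma norm_gam1_le {d : ℕ} (z : Euc d) : ‖gam1 z‖ ≤ (1 + ‖z‖ ^ 2) * gam z := by
  have := gam_pos z
  rw [gam1, norm_smul, rj_norm, Real.norm_eq_abs, abs_mul, abs_of_pos this]
  norm_num
  nlinarith [sq_nonneg (‖z‖ - 1), mul_nonneg this.le (sq_nonneg (‖z‖ - 1)),
    mul_nonneg this.le (sq_nonneg (‖z‖))]

lemma norm_gam2_le {d : ℕ} (z : Euc d) : ‖gam2 z‖ ≤ (1 + ‖z‖ ^ 2) * gam z := by
  have h0 := gam_pos z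
  rw [gam2]
  refine (norm_add_le _ _).trans ?_
  rw [norm_smul, ContinuousLinearMap.norm_smulRight_apply, norm_smul, gam1, norm_smul, rj_norm,
    Real.norm_eq_abs, Real.norm_eq_abs, abs_mul, abs_of_pos h0]
  have := rj_opNorm (d := d)
  have h1 : |(-(1 / 2) : ℝ)| = 1 / 2 := by norm_num
  rw [h1]
  have h2 : 1 / 2 * gam z * ‖(rj : Euc d →L[ℝ] (Euc d →L[ℝ] ℝ))‖ ≤ 1 / 2 * gam z * 1 := by gcongr
  nlinarith [mul_nonneg h0.le (sq_nonneg (‖z‖))]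

/-- Continuous kernels with Gaussian decay. -/
def GD {d : ℕ} {G : Type*} [NormedAddCommGroup G] (k : Euc d → G) : Prop :=
  Continuous k ∧ ∃ C, 0 ≤ C ∧ ∀ z, ‖k z‖ ≤ C * Real.exp (-(1 / 8) * ‖z‖ ^ 2)

lemma GD.of_le {d : ℕ} {G : Type*} [NormedAddCommGroup G] {k : Euc d → G} (hk : Continuous k)
    (h : ∀ z, ‖k z‖ ≤ (1 + ‖z‖ ^ 2) ^ 2 * gam z) : GD k :=
  ⟨hk, 256 * gc d, by have := gc_pos d; positivity, fun z => (h z).trans (gam_bound z)⟩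

lemma GD.gam {d : ℕ} : GD (gam : Euc d → ℝ) := GD.of_le continuous_gam fun z => by
  have h0 := gam_pos z
  rw [Real.norm_eq_abs, abs_of_pos h0]
  nlinarith [mul_nonneg h0.le (sq_nonneg (‖z‖)), mul_nonneg h0.le (sq_nonneg (‖z‖ ^ 2))]

lemma GD.gam1 {d : ℕ} : GD (gam1 : Euc d → _) := GD.of_le continuous_gam1 fun z => by
  have h0 := gam_pos z
  refine (norm_gam1_le z).trans ?_
  nlinarith [mul_nonneg h0.le (sq_nonneg (‖z‖)), mul_nonneg h0.le (sq_nonneg (‖z‖ ^ 2))]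

lemma GD.gam2 {d : ℕ} : GD (gam2 : Euc d → _) := GD.of_le continuous_gam2 fun z => by
  have h0 := gam_pos z
  refine (norm_gam2_le z).trans ?_
  nlinarith [mul_nonneg h0.le (sq_nonneg (‖z‖)), mul_nonneg h0.le (sq_nonneg (‖z‖ ^ 2))]

lemma GD.integrable {d : ℕ} {G : Type*} [NormedAddCommGroup G] {k : Euc d → G} (hk : GD k) :
    Integrable k := by
  obtain ⟨hc, C, hC, h⟩ := hk
  exact ((gauss_integrable d (by norm_num : (0:ℝ) < 1 / 8)).const_mul C).mono'
    hc.aestronglyMeasurable (Eventually.of_forall h)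

lemma rpow_le_one_add_sq {α t : ℝ} (hα0 : 0 < α) (hα1 : α ≤ 1) (ht : 0 ≤ t) :
    t ^ α ≤ 1 + t ^ 2 := by
  rcases le_total t 1 with h | h
  · have := Real.rpow_le_one ht h hα0.le
    nlinarith
  · have := Real.rpow_le_rpow_of_exponent_le h hα1
    rw [Real.rpow_one] at this
    nlinarith

lemma gam2_weight_integrable {d : ℕ} {α : ℝ} (hα0 : 0 < α) (hα1 : α ≤ 1) :
    Integrable fun z : Euc d => ‖z‖ ^ α * ‖gam2 z‖ := by
  have hc : Continuous fun z : Euc d => ‖z‖ ^ α * ‖gam2 z‖ :=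
    (continuous_norm.rpow_const (fun _ => Or.inr hα0.le)).mul continuous_gam2.norm
  refine GD.integrable (GD.of_le hc fun z => ?_)
  rw [Real.norm_eq_abs, abs_of_nonneg (by positivity), sq, mul_assoc]
  exact mul_le_mul (rpow_le_one_add_sq hα0 hα1 (norm_nonneg z)) (norm_gam2_le z) (norm_nonneg _)
    (by positivity)

end Part7

section Part8

open MeasureTheory Metric Filter

section TT
variable {d : ℕ} {G : Type*} [NormedAddCommGroup G] [NormedSpace ℝ G]

/-- Scaled convolution of `h` with the kernel `k`. -/
noncomputable def TT (k : Euc d → G) (h : Euc d → ℝ) (s : ℝ) (x : Euc d) : G :=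
  ∫ z, h (x - s • z) • k z

lemma norm_smul_le_of {a M : ℝ} {g : G} (h : |a| ≤ M) : ‖a • g‖ ≤ M * ‖g‖ := by
  rw [norm_smul, Real.norm_eq_abs]
  exact mul_le_mul_of_nonneg_right h (norm_nonneg _)

lemma TT_integrable {k : Euc d → G} (hk : GD k) {h : Euc d → ℝ} (hh : Continuous h) {M : ℝ}
    (hM : ∀ x, |h x| ≤ M) (s : ℝ) (x : Euc d) : Integrable fun z => h (x - s • z) • k z := by
  have := hk.1
  exact (hk.integrable.norm.const_mul M).mono' (by fun_prop)
    (Eventually.of_forall fun z => norm_smul_le_of (hM _))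

lemma TT_cont {k : Euc d → G} (hk : GD k) {h : Euc d → ℝ} (hh : Continuous h) {M : ℝ}
    (hM : ∀ x, |h x| ≤ M) : Continuous fun p : ℝ × Euc d => TT k h p.1 p.2 := by
  have := hk.1
  refine continuous_of_dominated (bound := fun z => M * ‖k z‖) (fun p => ?_) (fun p => ?_)
    (hk.integrable.norm.const_mul M) (Eventually.of_forall fun z => ?_)
  · fun_prop
  · exact Eventually.of_forall fun z => norm_smul_le_of (hM _)
  · fun_prop

lemma TT_cont_s {k : Euc d → G} (hk : GD k) {h : Euc d → ℝ} (hh : Continuous h) {M : ℝ}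
    (hM : ∀ x, |h x| ≤ M) (x : Euc d) : Continuous fun s => TT k h s x :=
  (TT_cont hk hh hM).comp (continuous_id.prodMk continuous_const)

lemma TT_cont_x {k : Euc d → G} (hk : GD k) {h : Euc d → ℝ} (hh : Continuous h) {M : ℝ}
    (hM : ∀ x, |h x| ≤ M) (s : ℝ) : Continuous fun x => TT k h s x :=
  (TT_cont hk hh hM).comp (continuous_const.prodMk continuous_id)

lemma TT_norm_le {k : Euc d → G} (hk : GD k) {h : Euc d → ℝ} {M : ℝ}
    (hM : ∀ x, |h x| ≤ M) (s : ℝ) (x : Euc d) : ‖TT k h s x‖ ≤ M * ∫ z, ‖k z‖ := by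
  rw [← integral_const_mul]
  exact norm_integral_le_of_norm_le (hk.integrable.norm.const_mul M)
    (Eventually.of_forall fun z => norm_smul_le_of (hM _))

lemma conv_hasFDerivAt {k : Euc d → G} {k' : Euc d → Euc d →L[ℝ] G} (hk : GD k)
    (hk' : GD k') (hd : ∀ z, HasFDerivAt k (k' z) z) {h : Euc d → ℝ} (hh : Continuous h) {M : ℝ}
    (hM : ∀ x, |h x| ≤ M) (x : Euc d) :
    HasFDerivAt (fun x => ∫ y, h y • k (x - y)) (∫ y, h y • k' (x - y)) x := by
  have hM0 : 0 ≤ M := (abs_nonneg _).trans (hM 0)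
  have c1 := hk.1
  have c2 := hk'.1
  obtain ⟨-, C, hC, hb⟩ := hk'
  have hIntg : Integrable fun y => h y • k (x - y) := by
    refine ((hk.integrable.comp_sub_left x).norm.const_mul M).mono' (by fun_prop)
      (Eventually.of_forall fun z => norm_smul_le_of (hM _))
  refine hasFDerivAt_integral_of_dominated_of_fderiv_le
    (F := fun x y => h y • k (x - y)) (F' := fun x y => h y • k' (x - y))
    (bound := fun y => M * (C * (Real.exp (1 / 8) * Real.exp (-(1 / 16) * ‖x - y‖ ^ 2))))
    (ball_mem_nhds x one_pos)
    (Eventually.of_forall fun y => by fun_prop) hIntg (by fun_prop)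
    (Eventually.of_forall fun y w hw => ?_) ?_ (Eventually.of_forall fun y w _ => ?_)
  · refine (norm_smul_le_of (G := Euc d →L[ℝ] G) (hM y)).trans ?_
    refine mul_le_mul_of_nonneg_left ((hb _).trans ?_) hM0
    refine mul_le_mul_of_nonneg_left ?_ hC
    rw [← Real.exp_add, Real.exp_le_exp]
    rw [mem_ball, dist_eq_norm] at hw
    have h1 : ‖x - y‖ ≤ ‖w - y‖ + ‖w - x‖ := by
      have : x - y = (w - y) - (w - x) := by abel
      rw [this]; exact norm_sub_le _ _
    have h2 : ‖x - y‖ ^ 2 ≤ (‖w - y‖ + 1) ^ 2 := by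
      gcongr; linarith
    nlinarith [sq_nonneg (‖w - y‖ - 1)]
  · refine Integrable.const_mul (Integrable.const_mul (Integrable.const_mul ?_ _) _) _
    exact (gauss_integrable d (by norm_num : (0:ℝ) < 1 / 16)).comp_sub_left x
  · have := (hd (w - y)).comp w ((hasFDerivAt_id w).sub_const y)
    exact this.const_smul (h y)

lemma TT_eq_conv {k : Euc d → G} {h : Euc d → ℝ} {s : ℝ} (hs : s ≠ 0) (x : Euc d) :
    TT k h s x = ∫ y, h (s • y) • k (s⁻¹ • x - y) := by
  rw [TT, ← integral_sub_left_eq_self _ volume (s⁻¹ • x)]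
  refine integral_congr_ae (Eventually.of_forall fun z => ?_)
  simp only [smul_sub, smul_inv_smul₀ hs, sub_sub_cancel]

lemma TT_hasFDerivAt {k : Euc d → G} {k' : Euc d → Euc d →L[ℝ] G} (hk : GD k)
    (hk' : GD k') (hd : ∀ z, HasFDerivAt k (k' z) z) {h : Euc d → ℝ} (hh : Continuous h) {M : ℝ}
    (hM : ∀ x, |h x| ≤ M) {s : ℝ} (hs : s ≠ 0) (x : Euc d) :
    HasFDerivAt (fun x => TT k h s x) (s⁻¹ • TT k' h s x) x := by
  have h1 := conv_hasFDerivAt hk hk' hd (h := fun y => h (s • y)) (by fun_prop) (fun y => hM _)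
    (s⁻¹ • x)
  have h2 : HasFDerivAt (fun x : Euc d => s⁻¹ • x) (s⁻¹ • ContinuousLinearMap.id ℝ (Euc d)) x :=
    (hasFDerivAt_id x).const_smul s⁻¹
  have h3 := h1.comp x h2
  have e : (fun x => TT k h s x) = fun x => ∫ y, h (s • y) • k (s⁻¹ • x - y) :=
    funext fun x => TT_eq_conv hs x
  rw [e, TT_eq_conv hs]
  refine h3.congr_fderiv ?_
  ext v
  simp

lemma integral_deriv_zero {k : Euc d → G} {k' : Euc d → Euc d →L[ℝ] G} (hk : GD k)
    (hk' : GD k') (hd : ∀ z, HasFDerivAt k (k' z) z) : ∫ z, k' z = 0 := by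
  have h1 := TT_hasFDerivAt hk hk' hd (h := fun _ => 1) continuous_const (M := 1) (by simp)
    one_ne_zero 0
  have h2 : (fun x => TT k (fun _ => (1:ℝ)) 1 x) = fun _ => ∫ z, k z := by
    funext x; simp [TT]
  rw [h2] at h1
  have h3 := h1.unique (hasFDerivAt_const _ _)
  simpa [TT] using h3

lemma TT_holder_le {k : Euc d → G} (hk : GD k) (h0 : ∫ z, k z = 0) {α : ℝ} (hα : 0 < α)
    (hki : Integrable fun z : Euc d => ‖z‖ ^ α * ‖k z‖)
    {h : Euc d → ℝ} (hh : Continuous h) {M : ℝ}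
    (hM : ∀ x, |h x| ≤ M) {C : ℝ} (hC : ∀ x y, |h x - h y| ≤ C * ‖x - y‖ ^ α)
    {s : ℝ} (hs : 0 ≤ s) (x : Euc d) :
    ‖TT k h s x‖ ≤ C * s ^ α * ∫ z : Euc d, ‖z‖ ^ α * ‖k z‖ := by
  have e : TT k h s x = ∫ z, (h (x - s • z) - h x) • k z := by
    simp only [sub_smul]
    rw [integral_sub (TT_integrable hk hh hM s x) (show Integrable fun z => h x • k z from hk.integrable.smul (h x)),
      integral_smul, h0]
    simp [TT]
  rw [e, ← integral_const_mul]
  refine norm_integral_le_of_norm_le (hki.const_mul _) (Eventually.of_forall fun z => ?_)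
  refine (norm_smul_le_of (hC _ _)).trans (le_of_eq ?_)
  rw [show x - s • z - x = -(s • z) by abel, norm_neg, norm_smul, Real.norm_eq_abs,
    abs_of_nonneg hs, Real.mul_rpow hs (norm_nonneg _)]
  ring

end TT

lemma integral_gam2 (d : ℕ) : ∫ z : Euc d, gam2 z = 0 :=
  integral_deriv_zero GD.gam1 GD.gam2 hasFDerivAt_gam1

/-- Radial derivative of the Gaussian convolution. -/
lemma TT_hasDerivAt_s {d : ℕ} {h : Euc d → ℝ} (hh : Continuous h) {M : ℝ}
    (hM : ∀ x, |h x| ≤ M) {s : ℝ} (hs : 0 < s) (x : Euc d) :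
    HasDerivAt (fun s => TT gam h s x) (s⁻¹ * TT (fun z => (‖z‖ ^ 2 / 2 - d) * gam z) h s x) s := by
  have hM0 : 0 ≤ M := (abs_nonneg _).trans (hM 0)
  have hgc : Continuous (gam : Euc d → ℝ) := continuous_gam
  -- change of variables
  have key : ∀ (k : Euc d → ℝ) (t : ℝ), 0 < t →
      TT k h t⁻¹ x = t ^ d * ∫ w, h (x - w) * k (t • w) := by
    intro k t ht
    have h1 := Measure.integral_comp_smul (volume : Measure (Euc d))
      (fun z => h (x - t⁻¹ • z) * k z) t
    simp only [inv_smul_smul₀ ht.ne'] at h1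
    rw [h1, TT]
    simp only [smul_eq_mul, finrank_euclideanSpace, Fintype.card_fin]
    rw [abs_of_pos (by positivity), ← mul_assoc, mul_inv_cancel₀ (by positivity), one_mul]
  set t₀ := s⁻¹ with ht₀
  have ht₀p : 0 < t₀ := inv_pos.2 hs
  have hD : HasDerivAt (fun t => ∫ w, h (x - w) * gam (t • w))
      (∫ w, h (x - w) * (-(1 / 2) * t₀ * ‖w‖ ^ 2 * gam (t₀ • w))) t₀ := by
    refine (hasDerivAt_integral_of_dominated_loc_of_deriv_le
      (F := fun t w => h (x - w) * gam (t • w))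
      (F' := fun t w => h (x - w) * (-(1 / 2) * t * ‖w‖ ^ 2 * gam (t • w)))
      (bound := fun w => M * (4 / t₀ * (256 * gc d *
        Real.exp (-(1 / 8 * (t₀ / 2) ^ 2) * ‖w‖ ^ 2))))
      (Ioo_mem_nhds (by linarith : t₀ / 2 < t₀) (by linarith : t₀ < 2 * t₀))
      (Eventually.of_forall fun t => by fun_prop) ?_ (by fun_prop)
      (Eventually.of_forall fun w t ht => ?_) ?_ (Eventually.of_forall fun w t _ => ?_)).2
    · have : Integrable fun w : Euc d => gam (t₀ • w) := GD.gam.integrable.comp_smul ht₀p.ne'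
      exact (this.norm.const_mul M).mono' (by fun_prop)
        (Eventually.of_forall fun z => norm_smul_le_of (hM _))
    · refine (norm_smul_le_of (hM _)).trans (mul_le_mul_of_nonneg_left ?_ hM0)
      obtain ⟨ht1, ht2⟩ := ht
      have htp : 0 < t := by linarith
      have hg := gam_pos (t • w)
      have hb := gam_bound (t • w)
      rw [norm_smul, Real.norm_eq_abs, abs_of_pos htp] at hb
      have e1 : ‖-(1 / 2) * t * ‖w‖ ^ 2 * gam (t • w)‖ = 1 / 2 * t * ‖w‖ ^ 2 * gam (t • w) := by
        rw [Real.norm_eq_abs, show -(1 / 2) * t * ‖w‖ ^ 2 * gam (t • w)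
          = -(1 / 2 * t * ‖w‖ ^ 2 * gam (t • w)) by ring, abs_neg, abs_of_nonneg (by positivity)]
      rw [e1]
      have e2 : 1 / 2 * t * ‖w‖ ^ 2 * gam (t • w) =
          (1 / (2 * t)) * ((t * ‖w‖) ^ 2 * gam (t • w)) := by field_simp
      have e3 : (t * ‖w‖) ^ 2 * gam (t • w) ≤ (1 + (t * ‖w‖) ^ 2) ^ 2 * gam (t • w) := by
        gcongr; nlinarith [sq_nonneg (t * ‖w‖), sq_nonneg ((t * ‖w‖) ^ 2)]
      have e4 : Real.exp (-(1 / 8) * (t * ‖w‖) ^ 2) ≤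
          Real.exp (-(1 / 8 * (t₀ / 2) ^ 2) * ‖w‖ ^ 2) := by
        rw [Real.exp_le_exp]
        have : (t₀ / 2) ^ 2 ≤ t ^ 2 := by gcongr
        nlinarith [mul_le_mul_of_nonneg_right this (sq_nonneg ‖w‖)]
      have e5 : 1 / (2 * t) ≤ 4 / t₀ := by
        rw [div_le_div_iff₀ (by positivity) ht₀p]; linarith
      rw [e2]
      have hgc0 := gc_pos d
      calc _ ≤ 4 / t₀ * (256 * gc d * Real.exp (-(1 / 8) * (t * ‖w‖) ^ 2)) := by
            exact mul_le_mul e5 (e3.trans hb) (by positivity) (by positivity)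
        _ ≤ _ := by gcongr
    · exact (((gauss_integrable d (by positivity)).const_mul _).const_mul _).const_mul _
    · have h1 : HasDerivAt (fun t : ℝ => t • w) w t := by
        simpa using (hasDerivAt_id t).smul_const w
      have h2 := (hasFDerivAt_gam (t • w)).comp_hasDerivAt t h1
      refine (h2.const_mul (h (x - w))).congr_deriv ?_
      simp only [gam1, smul_apply, rj_apply, inner_smul_left, smul_eq_mul,
        real_inner_self_eq_norm_sq, conj_trivial]
      ring
  have hI : HasDerivAt (fun t : ℝ => t ^ d * ∫ w, h (x - w) * gam (t • w))
      (-t₀⁻¹ * TT (fun z => (‖z‖ ^ 2 / 2 - d) * gam z) h s x) t₀ := by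
    have h1 := (hasDerivAt_pow d t₀).mul hD
    refine h1.congr_deriv ?_
    have es : s = t₀⁻¹ := by rw [ht₀, inv_inv]
    rw [es, key _ t₀ ht₀p]
    have i1 : Integrable fun w : Euc d => h (x - w) * gam (t₀ • w) := by
      have : Integrable fun w : Euc d => gam (t₀ • w) := GD.gam.integrable.comp_smul ht₀p.ne'
      exact (this.norm.const_mul M).mono' (by fun_prop)
        (Eventually.of_forall fun z => norm_smul_le_of (hM _))
    have hGDk : GD fun z : Euc d => ‖z‖ ^ 2 * gam z := by
      refine GD.of_le (by fun_prop) fun z => ?_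
      have hg := gam_pos z
      rw [Real.norm_eq_abs, abs_of_nonneg (by positivity)]
      gcongr; nlinarith [sq_nonneg (‖z‖), sq_nonneg (‖z‖ ^ 2)]
    have i2 : Integrable fun w : Euc d => h (x - w) * (‖t₀ • w‖ ^ 2 * gam (t₀ • w)) := by
      have : Integrable fun w : Euc d => ‖t₀ • w‖ ^ 2 * gam (t₀ • w) :=
        hGDk.integrable.comp_smul ht₀p.ne'
      exact (this.norm.const_mul M).mono' (by fun_prop)
        (Eventually.of_forall fun z => norm_smul_le_of (hM _))
    have e1 : ∫ w, h (x - w) * (-(1 / 2) * t₀ * ‖w‖ ^ 2 * gam (t₀ • w)) =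
        -(1 / 2) * t₀⁻¹ * ∫ w, h (x - w) * (‖t₀ • w‖ ^ 2 * gam (t₀ • w)) := by
      rw [← integral_const_mul]
      refine integral_congr_ae (Eventually.of_forall fun w => ?_)
      simp only [norm_smul, Real.norm_eq_abs, abs_of_pos ht₀p]
      field_simp
    have e2 : ∫ w, h (x - w) * ((‖t₀ • w‖ ^ 2 / 2 - d) * gam (t₀ • w)) =
        1 / 2 * (∫ w, h (x - w) * (‖t₀ • w‖ ^ 2 * gam (t₀ • w))) -
          d * ∫ w, h (x - w) * gam (t₀ • w) := by
      rw [← integral_const_mul, ← integral_const_mul,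
        ← integral_sub (i2.const_mul _) (i1.const_mul _)]
      refine integral_congr_ae (Eventually.of_forall fun w => ?_)
      simp only []
      ring
    rw [e1, e2]
    have e3 : (d : ℝ) * t₀ ^ (d - 1) = d * (t₀⁻¹ * t₀ ^ d) := by
      rcases Nat.eq_zero_or_pos d with h0 | h0
      · subst h0; simp
      · rw [← Nat.succ_pred_eq_of_pos h0]
        simp only [Nat.pred_eq_sub_one, Nat.succ_eq_add_one, add_tsub_cancel_right, pow_succ]
        field_simp
    rw [e3]
    ring
  have hcomp := hI.comp s (hasDerivAt_inv hs.ne')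
  have hev : (fun s => TT gam h s x) =ᶠ[nhds s]
      ((fun t : ℝ => t ^ d * ∫ w, h (x - w) * gam (t • w)) ∘ fun s => s⁻¹) := by
    filter_upwards [lt_mem_nhds hs] with t ht
    have := key gam t⁻¹ (inv_pos.2 ht)
    rw [inv_inv] at this
    exact this
  refine (hcomp.congr_of_eventuallyEq hev).congr_deriv ?_
  rw [ht₀, inv_inv]
  field_simp

end Part8

section Part9

open MeasureTheory Metric Filter

lemma w0_int {κ : ℝ} (hκ : 0 < κ) :
    IntegrableOn (fun s : ℝ => 2 * s * Real.exp (-κ * s ^ 2)) (Set.Ioi 0) := by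
  have := ((integrable_mul_exp_neg_mul_sq hκ).const_mul 2).integrableOn (s := Set.Ioi (0:ℝ))
  simpa only [mul_assoc] using this

lemma w1_int {κ : ℝ} (hκ : 0 < κ) :
    IntegrableOn (fun s : ℝ => 2 * Real.exp (-κ * s ^ 2)) (Set.Ioi 0) :=
  ((integrable_exp_neg_mul_sq hκ).const_mul 2).integrableOn

lemma w2_int {κ α : ℝ} (hκ : 0 < κ) (hα : 0 < α) :
    IntegrableOn (fun s : ℝ => 2 * (s ^ (α - 1) * Real.exp (-κ * s ^ 2))) (Set.Ioi 0) :=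
  (integrableOn_rpow_mul_exp_neg_mul_sq hκ (by linarith)).const_mul 2

/-- The resolvent of the Laplacian, via the heat kernel (with `t = s²`). -/
noncomputable def AA {d : ℕ} (κ : ℝ) (h : Euc d → ℝ) (x : Euc d) : ℝ :=
  ∫ s in Set.Ioi (0:ℝ), (2 * s * Real.exp (-κ * s ^ 2)) * TT gam h s x

/-- First derivative of the resolvent. -/
noncomputable def AA1 {d : ℕ} (κ : ℝ) (h : Euc d → ℝ) (x : Euc d) : Euc d →L[ℝ] ℝ :=
  ∫ s in Set.Ioi (0:ℝ), (2 * Real.exp (-κ * s ^ 2)) • TT gam1 h s x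

/-- Second derivative of the resolvent. -/
noncomputable def AA2 {d : ℕ} (κ : ℝ) (h : Euc d → ℝ) (x : Euc d) :
    Euc d →L[ℝ] (Euc d →L[ℝ] ℝ) :=
  ∫ s in Set.Ioi (0:ℝ), (2 * s⁻¹ * Real.exp (-κ * s ^ 2)) • TT gam2 h s x

section A
variable {d : ℕ} {κ M : ℝ} {h : Euc d → ℝ}

lemma TT_gam_le (hM : ∀ x, |h x| ≤ M) (s : ℝ) (x : Euc d) : |TT gam h s x| ≤ M := by
  have h1 := TT_norm_le GD.gam hM s x
  have h2 : ∫ z : Euc d, ‖gam z‖ = 1 := by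
    rw [← integral_gam d]
    exact integral_congr_ae (Eventually.of_forall fun z => by
      simp only [Real.norm_eq_abs]; exact abs_of_pos (gam_pos z))
  rwa [h2, mul_one, Real.norm_eq_abs] at h1

lemma AA_integrable (hκ : 0 < κ) (hh : Continuous h) (hM : ∀ x, |h x| ≤ M) (x : Euc d) :
    IntegrableOn (fun s => (2 * s * Real.exp (-κ * s ^ 2)) * TT gam h s x) (Set.Ioi 0) := by
  have c := TT_cont_s GD.gam hh hM x
  refine ((w0_int hκ).norm.mul_const M).mono' (by fun_prop) (Eventually.of_forall fun s => ?_)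
  rw [norm_mul]
  exact mul_le_mul_of_nonneg_left (TT_gam_le hM s x) (norm_nonneg _)

lemma AA1_integrable (hκ : 0 < κ) (hh : Continuous h) (hM : ∀ x, |h x| ≤ M) (x : Euc d) :
    IntegrableOn (fun s => (2 * Real.exp (-κ * s ^ 2)) • TT gam1 h s x) (Set.Ioi 0) := by
  have c := TT_cont_s GD.gam1 hh hM x
  refine ((w1_int hκ).norm.mul_const (M * ∫ z : Euc d, ‖gam1 z‖)).mono' (by fun_prop)
    (Eventually.of_forall fun s => ?_)
  rw [norm_smul]
  exact mul_le_mul_of_nonneg_left (TT_norm_le GD.gam1 hM s x) (norm_nonneg _)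

lemma AA_hasFDerivAt (hκ : 0 < κ) (hh : Continuous h) (hM : ∀ x, |h x| ≤ M) (x : Euc d) :
    HasFDerivAt (AA κ h) (AA1 κ h x) x := by
  refine hasFDerivAt_integral_of_dominated_of_fderiv_le (μ := volume.restrict (Set.Ioi 0))
    (F := fun x s => (2 * s * Real.exp (-κ * s ^ 2)) * TT gam h s x)
    (F' := fun x s => (2 * Real.exp (-κ * s ^ 2)) • TT gam1 h s x)
    (bound := fun s => ‖2 * Real.exp (-κ * s ^ 2)‖ * (M * ∫ z : Euc d, ‖gam1 z‖))
    (ball_mem_nhds x one_pos)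
    (Eventually.of_forall fun y => (AA_integrable hκ hh hM y).aestronglyMeasurable)
    (AA_integrable hκ hh hM x) (AA1_integrable hκ hh hM x).aestronglyMeasurable
    (Eventually.of_forall fun s w _ => ?_) ((w1_int hκ).norm.mul_const _)
    ((ae_restrict_mem measurableSet_Ioi).mono fun s hs w _ => ?_)
  · rw [norm_smul]
    exact mul_le_mul_of_nonneg_left (TT_norm_le GD.gam1 hM s w) (norm_nonneg _)
  · have hs0 : s ≠ 0 := ne_of_gt hs
    have h1 := (TT_hasFDerivAt GD.gam GD.gam1 hasFDerivAt_gam hh hM hs0 w).const_mul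
      (2 * s * Real.exp (-κ * s ^ 2))
    refine h1.congr_fderiv ?_
    rw [smul_smul]
    congr 1
    field_simp

lemma AA1_le (hκ : 0 < κ) (hM : ∀ x, |h x| ≤ M) (x : Euc d) :
    ‖AA1 κ h x‖ ≤ (∫ s in Set.Ioi (0:ℝ), 2 * Real.exp (-κ * s ^ 2)) *
      (M * ∫ z : Euc d, ‖gam1 z‖) := by
  rw [AA1, ← integral_mul_const]
  refine norm_integral_le_of_norm_le ((w1_int hκ).mul_const _) (Eventually.of_forall fun s => ?_)
  rw [norm_smul, Real.norm_eq_abs, abs_of_pos (by positivity)]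
  exact mul_le_mul_of_nonneg_left (TT_norm_le GD.gam1 hM s x) (by positivity)

lemma AA_lip (hκ : 0 < κ) (hh : Continuous h) (hM : ∀ x, |h x| ≤ M) (x y : Euc d) :
    |AA κ h x - AA κ h y| ≤ (∫ s in Set.Ioi (0:ℝ), 2 * Real.exp (-κ * s ^ 2)) *
      (M * ∫ z : Euc d, ‖gam1 z‖) * ‖x - y‖ :=
  convex_univ.norm_image_sub_le_of_norm_hasFDerivWithin_le
    (fun z _ => (AA_hasFDerivAt hκ hh hM z).hasFDerivWithinAt) (fun z _ => AA1_le hκ hM z)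
    (Set.mem_univ y) (Set.mem_univ x)

lemma AA_abs_le (hκ : 0 < κ) (hM : ∀ x, |h x| ≤ M) (x : Euc d) :
    |AA κ h x| ≤ (∫ s in Set.Ioi (0:ℝ), 2 * s * Real.exp (-κ * s ^ 2)) * M := by
  rw [AA, ← integral_mul_const]
  rw [← Real.norm_eq_abs]
  refine norm_integral_le_of_norm_le ((w0_int hκ).mul_const _)
    ((ae_restrict_mem measurableSet_Ioi).mono fun s hs => ?_)
  have hs' : 0 < s := hs
  rw [norm_mul, Real.norm_eq_abs, abs_of_pos (by positivity)]
  exact mul_le_mul_of_nonneg_left (TT_gam_le hM s x) (by positivity)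

variable {α C : ℝ}

lemma gam2_pt (hα0 : 0 < α) (hα1 : α ≤ 1) (hh : Continuous h) (hM : ∀ x, |h x| ≤ M)
    (hC : ∀ x y, |h x - h y| ≤ C * ‖x - y‖ ^ α) {s : ℝ} (hs : 0 < s) (x : Euc d) :
    ‖(2 * s⁻¹ * Real.exp (-κ * s ^ 2)) • TT gam2 h s x‖ ≤
      2 * (s ^ (α - 1) * Real.exp (-κ * s ^ 2)) * (C * ∫ z : Euc d, ‖z‖ ^ α * ‖gam2 z‖) := by
  have h1 := TT_holder_le GD.gam2 (integral_gam2 d) hα0 (gam2_weight_integrable hα0 hα1)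
    hh hM hC hs.le x
  rw [norm_smul, Real.norm_eq_abs, abs_of_pos (by positivity), Real.rpow_sub_one hs.ne']
  refine (mul_le_mul_of_nonneg_left h1 (by positivity)).trans (le_of_eq ?_)
  field_simp

lemma AA2_integrable (hκ : 0 < κ) (hα0 : 0 < α) (hα1 : α ≤ 1) (hh : Continuous h)
    (hM : ∀ x, |h x| ≤ M) (hC : ∀ x y, |h x - h y| ≤ C * ‖x - y‖ ^ α) (x : Euc d) :
    IntegrableOn (fun s => (2 * s⁻¹ * Real.exp (-κ * s ^ 2)) • TT gam2 h s x) (Set.Ioi 0) := by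
  have c := TT_cont_s GD.gam2 hh hM x
  refine ((w2_int hκ hα0).mul_const (C * ∫ z : Euc d, ‖z‖ ^ α * ‖gam2 z‖)).mono' ?_
    ((ae_restrict_mem measurableSet_Ioi).mono fun s hs => ?_)
  · have : Measurable fun s : ℝ => 2 * s⁻¹ * Real.exp (-κ * s ^ 2) := by fun_prop
    exact (this.stronglyMeasurable.smul c.stronglyMeasurable).aestronglyMeasurable
  · exact gam2_pt hα0 hα1 hh hM hC hs x

lemma AA1_hasFDerivAt (hκ : 0 < κ) (hα0 : 0 < α) (hα1 : α ≤ 1) (hh : Continuous h)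
    (hM : ∀ x, |h x| ≤ M) (hC : ∀ x y, |h x - h y| ≤ C * ‖x - y‖ ^ α) (x : Euc d) :
    HasFDerivAt (AA1 κ h) (AA2 κ h x) x := by
  refine hasFDerivAt_integral_of_dominated_of_fderiv_le (μ := volume.restrict (Set.Ioi 0))
    (F := fun x s => (2 * Real.exp (-κ * s ^ 2)) • TT gam1 h s x)
    (F' := fun x s => (2 * s⁻¹ * Real.exp (-κ * s ^ 2)) • TT gam2 h s x)
    (bound := fun s => 2 * (s ^ (α - 1) * Real.exp (-κ * s ^ 2)) *
      (C * ∫ z : Euc d, ‖z‖ ^ α * ‖gam2 z‖))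
    (ball_mem_nhds x one_pos)
    (Eventually.of_forall fun y => (AA1_integrable hκ hh hM y).aestronglyMeasurable)
    (AA1_integrable hκ hh hM x) (AA2_integrable hκ hα0 hα1 hh hM hC x).aestronglyMeasurable
    ((ae_restrict_mem measurableSet_Ioi).mono fun s hs w _ => gam2_pt hα0 hα1 hh hM hC hs w)
    ((w2_int hκ hα0).mul_const _)
    ((ae_restrict_mem measurableSet_Ioi).mono fun s hs w _ => ?_)
  have hs0 : s ≠ 0 := ne_of_gt hs
  have h1 := (TT_hasFDerivAt GD.gam1 GD.gam2 hasFDerivAt_gam1 hh hM hs0 w).const_smul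
    (2 * Real.exp (-κ * s ^ 2))
  refine h1.congr_fderiv ?_
  rw [smul_smul]
  congr 1
  ring

lemma AA2_continuous (hκ : 0 < κ) (hα0 : 0 < α) (hα1 : α ≤ 1) (hh : Continuous h)
    (hM : ∀ x, |h x| ≤ M) (hC : ∀ x y, |h x - h y| ≤ C * ‖x - y‖ ^ α) :
    Continuous (AA2 κ h) := by
  refine continuous_of_dominated (bound := fun s => 2 * (s ^ (α - 1) * Real.exp (-κ * s ^ 2)) *
      (C * ∫ z : Euc d, ‖z‖ ^ α * ‖gam2 z‖))
    (fun x => (AA2_integrable hκ hα0 hα1 hh hM hC x).aestronglyMeasurable)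
    (fun x => (ae_restrict_mem measurableSet_Ioi).mono fun s hs => gam2_pt hα0 hα1 hh hM hC hs x)
    ((w2_int hκ hα0).mul_const _) (Eventually.of_forall fun s => ?_)
  exact (TT_cont_x GD.gam2 hh hM s).const_smul (2 * s⁻¹ * Real.exp (-κ * s ^ 2))

lemma AA_contDiff (hκ : 0 < κ) (hα0 : 0 < α) (hα1 : α ≤ 1) (hh : Continuous h)
    (hM : ∀ x, |h x| ≤ M) (hC : ∀ x y, |h x - h y| ≤ C * ‖x - y‖ ^ α) :
    ContDiff ℝ 2 (AA κ h) := by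
  have e1 : fderiv ℝ (AA κ h) = AA1 κ h := funext fun x => (AA_hasFDerivAt hκ hh hM x).fderiv
  have e2 : fderiv ℝ (AA1 κ h) = AA2 κ h :=
    funext fun x => (AA1_hasFDerivAt hκ hα0 hα1 hh hM hC x).fderiv
  have h1 : ContDiff ℝ 1 (AA1 κ h) := contDiff_one_iff_fderiv.2
    ⟨fun x => (AA1_hasFDerivAt hκ hα0 hα1 hh hM hC x).differentiableAt,
      e2 ▸ AA2_continuous hκ hα0 hα1 hh hM hC⟩
  rw [show (2 : WithTop ℕ∞) = 1 + 1 by norm_num, contDiff_succ_iff_fderiv]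
  exact ⟨fun x => (AA_hasFDerivAt hκ hh hM x).differentiableAt, by simp, e1 ▸ h1⟩

/-- Trace functional. -/
noncomputable def trc (d : ℕ) : (Euc d →L[ℝ] (Euc d →L[ℝ] ℝ)) →L[ℝ] ℝ :=
  ∑ i : Fin d, (ContinuousLinearMap.apply ℝ ℝ (eb i)).comp
    (ContinuousLinearMap.apply ℝ (Euc d →L[ℝ] ℝ) (eb i))

lemma trc_apply (L : Euc d →L[ℝ] (Euc d →L[ℝ] ℝ)) : trc d L = ∑ i, L (eb i) (eb i) := by
  simp [trc]

lemma trc_TT (hh : Continuous h) (hM : ∀ x, |h x| ≤ M) (s : ℝ) (x : Euc d) :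
    2 * trc d (TT gam2 h s x) = TT (fun z => (‖z‖ ^ 2 / 2 - d) * gam z) h s x := by
  rw [TT, ← ContinuousLinearMap.integral_comp_comm _ (TT_integrable GD.gam2 hh hM s x), TT,
    ← integral_const_mul]
  refine integral_congr_ae (Eventually.of_forall fun z => ?_)
  simp only [map_smul, trc_apply, trace_gam2, smul_eq_mul]
  ring

lemma AA_eq (hκ : 0 < κ) (hα0 : 0 < α) (hα1 : α ≤ 1) (hh : Continuous h)
    (hM : ∀ x, |h x| ≤ M) (hC : ∀ x y, |h x - h y| ≤ C * ‖x - y‖ ^ α) (x : Euc d) :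
    -laplacian (AA κ h) x + κ * AA κ h x = h x := by
  have e1 : fderiv ℝ (AA κ h) = AA1 κ h := funext fun x => (AA_hasFDerivAt hκ hh hM x).fderiv
  have e2 := (AA1_hasFDerivAt hκ hα0 hα1 hh hM hC x).fderiv
  have i2 := AA2_integrable hκ hα0 hα1 hh hM hC x
  have i0 := AA_integrable hκ hh hM x
  have e3 : laplacian (AA κ h) x = ∫ s in Set.Ioi (0:ℝ),
      (2 * s⁻¹ * Real.exp (-κ * s ^ 2)) * trc d (TT gam2 h s x) := by
    rw [laplacian, e1, e2, ← trc_apply, AA2, ← ContinuousLinearMap.integral_comp_comm _ i2]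
    simp only [map_smul, smul_eq_mul]
  have i3 : IntegrableOn (fun s =>
      (2 * s⁻¹ * Real.exp (-κ * s ^ 2)) * trc d (TT gam2 h s x)) (Set.Ioi 0) := by
    have := (trc d).integrable_comp i2
    simp only [map_smul, smul_eq_mul] at this
    exact this
  have hft := integral_Ioi_of_hasDerivAt_of_tendsto (a := 0) (m := 0)
    (f := fun s => Real.exp (-κ * s ^ 2) * TT gam h s x)
    (f' := fun s => (2 * s⁻¹ * Real.exp (-κ * s ^ 2)) * trc d (TT gam2 h s x) -
      κ * ((2 * s * Real.exp (-κ * s ^ 2)) * TT gam h s x)) ?_ ?_ ?_ ?_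
  · rw [integral_sub i3 (i0.const_mul κ), integral_const_mul, ← e3, ← AA] at hft
    have : TT gam h 0 x = h x := by
      simp only [TT, zero_smul, sub_zero, smul_eq_mul]
      rw [integral_const_mul, integral_gam, mul_one]
    simp only [this] at hft
    simp at hft
    linarith
  · have := TT_cont_s GD.gam hh hM x
    exact Continuous.continuousWithinAt (by fun_prop)
  · intro s hs
    have h1 := TT_hasDerivAt_s hh hM hs x
    rw [← trc_TT hh hM] at h1
    have h2 : HasDerivAt (fun s : ℝ => Real.exp (-κ * s ^ 2))
        (Real.exp (-κ * s ^ 2) * (-κ * (2 * s))) s := by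
      have := ((hasDerivAt_pow 2 s).const_mul (-κ)).exp
      simpa using this
    refine (h2.mul h1).congr_deriv ?_
    ring
  · exact i3.sub (i0.const_mul κ)
  · have hlim : Tendsto (fun s : ℝ => Real.exp (-κ * s ^ 2) * M) atTop (nhds 0) := by
      rw [← zero_mul M]
      refine Tendsto.mul_const _ (Real.tendsto_exp_atBot.comp ?_)
      exact (tendsto_pow_atTop (by norm_num)).const_mul_atTop_of_neg (by linarith)
    refine squeeze_zero_norm (fun s => ?_) hlim
    rw [norm_mul, Real.norm_eq_abs, abs_of_pos (Real.exp_pos _)]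
    exact mul_le_mul_of_nonneg_left (TT_gam_le hM s x) (Real.exp_pos _).le

end A

end Part9

section Part10

open MeasureTheory Metric Filter

section B
variable {d : ℕ} {κ M : ℝ} {h g : Euc d → ℝ}

lemma TT_mono (hh : Continuous h) (hM : ∀ x, |h x| ≤ M) {M' : ℝ} (hg : Continuous g)
    (hM' : ∀ x, |g x| ≤ M') (hle : ∀ x, h x ≤ g x) (s : ℝ) (x : Euc d) :
    TT gam h s x ≤ TT gam g s x :=
  integral_mono (TT_integrable GD.gam hh hM s x) (TT_integrable GD.gam hg hM' s x) fun z =>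
    mul_le_mul_of_nonneg_right (hle _) (gam_pos z).le

lemma AA_mono (hκ : 0 < κ) (hh : Continuous h) (hM : ∀ x, |h x| ≤ M) {M' : ℝ} (hg : Continuous g)
    (hM' : ∀ x, |g x| ≤ M') (hle : ∀ x, h x ≤ g x) (x : Euc d) : AA κ h x ≤ AA κ g x := by
  refine setIntegral_mono_on (AA_integrable hκ hh hM x) (AA_integrable hκ hg hM' x)
    measurableSet_Ioi fun s hs => ?_
  have hs' : 0 < s := hs
  exact mul_le_mul_of_nonneg_left (TT_mono hh hM hg hM' hle s x) (by positivity)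

lemma AA_zero (x : Euc d) : AA κ (fun _ => 0) x = 0 := by simp [AA, TT]

lemma TT_pos (hh : Continuous h) (hM : ∀ x, |h x| ≤ M) (h0 : ∀ x, 0 ≤ h x) {x₀ : Euc d}
    (hx₀ : 0 < h x₀) {s : ℝ} (hs : 0 < s) (x : Euc d) : 0 < TT gam h s x := by
  have hi := TT_integrable GD.gam hh hM s x
  have hc : Continuous fun z => h (x - s • z) • gam z := by
    have : Continuous (gam : Euc d → ℝ) := continuous_gam
    fun_prop
  refine (integral_pos_iff_support_of_nonneg
    (fun z => mul_nonneg (h0 _) (gam_pos z).le) hi).2 ?_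
  refine hc.isOpen_support.measure_pos volume ⟨s⁻¹ • (x - x₀), ?_⟩
  rw [Function.mem_support, smul_inv_smul₀ hs.ne', sub_sub_cancel]
  exact (mul_pos hx₀ (gam_pos _)).ne'

lemma AA_pos (hκ : 0 < κ) (hh : Continuous h) (hM : ∀ x, |h x| ≤ M) (h0 : ∀ x, 0 ≤ h x)
    {x₀ : Euc d} (hx₀ : 0 < h x₀) (x : Euc d) : 0 < AA κ h x := by
  have hp : ∀ s ∈ Set.Ioi (0:ℝ), 0 < (2 * s * Real.exp (-κ * s ^ 2)) * TT gam h s x := by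
    intro s hs
    have hs' : 0 < s := hs
    have := TT_pos hh hM h0 hx₀ hs x
    positivity
  refine (setIntegral_pos_iff_support_of_nonneg_ae
    ((ae_restrict_mem measurableSet_Ioi).mono fun s hs => (hp s hs).le)
    (AA_integrable hκ hh hM x)).2 ?_
  have : Set.Ioi (0:ℝ) ⊆
      (Function.support fun s => 2 * s * Real.exp (-κ * s ^ 2) * TT gam h s x) :=
    fun s hs => (hp s hs).ne'
  rw [Set.inter_eq_right.2 this]
  simp

lemma TT_tendsto {hn : ℕ → Euc d → ℝ} (hnc : ∀ n, Continuous (hn n)) (hnM : ∀ n x, |hn n x| ≤ M)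
    (hlim : ∀ x, Tendsto (fun n => hn n x) atTop (nhds (h x))) (s : ℝ) (x : Euc d) :
    Tendsto (fun n => TT gam (hn n) s x) atTop (nhds (TT gam h s x)) := by
  have hg : Continuous (gam : Euc d → ℝ) := continuous_gam
  refine tendsto_integral_of_dominated_convergence (fun z => M * ‖gam z‖) (fun n => ?_)
    (GD.gam.integrable.norm.const_mul M)
    (fun n => Eventually.of_forall fun z => norm_smul_le_of (hnM n _))
    (Eventually.of_forall fun z => (hlim _).smul_const _)
  have := hnc n
  fun_prop

lemma AA_tendsto (hκ : 0 < κ) {hn : ℕ → Euc d → ℝ} (hnc : ∀ n, Continuous (hn n))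
    (hnM : ∀ n x, |hn n x| ≤ M)
    (hlim : ∀ x, Tendsto (fun n => hn n x) atTop (nhds (h x))) (x : Euc d) :
    Tendsto (fun n => AA κ (hn n) x) atTop (nhds (AA κ h x)) := by
  refine tendsto_integral_of_dominated_convergence
    (fun s => ‖2 * s * Real.exp (-κ * s ^ 2)‖ * M)
    (fun n => (AA_integrable hκ (hnc n) (hnM n) x).aestronglyMeasurable)
    ((w0_int hκ).norm.mul_const M)
    (fun n => Eventually.of_forall fun s => ?_)
    (Eventually.of_forall fun s => (TT_tendsto hnc hnM hlim s x).const_mul _)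
  rw [norm_mul]
  exact mul_le_mul_of_nonneg_left (TT_gam_le (hnM n) s x) (norm_nonneg _)

lemma TT_L2 (hi : Integrable fun x => h x ^ 2)
    {s : ℝ} (hs : 0 < s) (x : Euc d) :
    |TT gam h s x| ≤ 1 / 2 + 1 / 2 * (gc d * ((s ^ d)⁻¹ * ∫ y, h y ^ 2)) := by
  have i1 : Integrable fun z : Euc d => h (x - s • z) ^ 2 :=
    (hi.comp_sub_left x).comp_smul hs.ne'
  have e1 : ∫ z : Euc d, h (x - s • z) ^ 2 = (s ^ d)⁻¹ * ∫ y, h y ^ 2 := by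
    have h1 := Measure.integral_comp_smul (volume : Measure (Euc d)) (fun z => h (x - z) ^ 2) s
    rw [h1, integral_sub_left_eq_self (fun z => h z ^ 2) volume x]
    simp only [finrank_euclideanSpace, Fintype.card_fin, smul_eq_mul]
    rw [abs_of_pos (by positivity)]
  have e2 : 1 / 2 + 1 / 2 * (gc d * ((s ^ d)⁻¹ * ∫ y, h y ^ 2)) =
      ∫ z : Euc d, (1 / 2 * gam z + 1 / 2 * (gc d * h (x - s • z) ^ 2)) := by
    rw [integral_add (GD.gam.integrable.const_mul _) ((i1.const_mul _).const_mul _),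
      integral_const_mul, integral_const_mul, integral_const_mul, integral_gam, e1, mul_one]
  rw [e2, ← Real.norm_eq_abs]
  refine norm_integral_le_of_norm_le ((GD.gam.integrable.const_mul _).add
    ((i1.const_mul _).const_mul _)) (Eventually.of_forall fun z => ?_)
  have hg := gam_pos z
  have hg1 : gam z ≤ gc d := by
    rw [gam]
    have : Real.exp (-(1 / 4) * ‖z‖ ^ 2) ≤ 1 := Real.exp_le_one_iff.2 (by nlinarith [sq_nonneg ‖z‖])
    have := mul_le_mul_of_nonneg_left this (gc_pos d).le
    linarith
  rw [norm_smul, Real.norm_eq_abs, Real.norm_eq_abs, abs_of_pos hg]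
  set a := h (x - s • z)
  have h1 : |a| ≤ 1 / 2 + 1 / 2 * a ^ 2 := by
    rw [← sq_abs a]; nlinarith [sq_nonneg (|a| - 1)]
  have h2 := mul_le_mul_of_nonneg_right h1 hg.le
  have h3 := mul_le_mul_of_nonneg_right hg1 (sq_nonneg a)
  show |a| * gam z ≤ 1 / 2 * gam z + 1 / 2 * (gc d * a ^ 2)
  linarith

lemma AA_split (hκ : 0 < κ) (hh : Continuous h) (hM : ∀ x, |h x| ≤ M)
    (hi : Integrable fun x => h x ^ 2) {Q : ℝ} (hQ : ∫ x, h x ^ 2 ≤ Q) {δ : ℝ} (hδ : 0 < δ)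
    (x : Euc d) :
    |AA κ h x| ≤ 2 * δ ^ 2 * M + (∫ s in Set.Ioi (0:ℝ), 2 * s * Real.exp (-κ * s ^ 2)) *
      (1 / 2 + 1 / 2 * (gc d * ((δ ^ d)⁻¹ * Q))) := by
  have hM0 : 0 ≤ M := (abs_nonneg _).trans (hM 0)
  have hQ0 : 0 ≤ Q := (integral_nonneg fun x => sq_nonneg (h x)).trans hQ
  have hgc := gc_pos d
  set K := 1 / 2 + 1 / 2 * (gc d * ((δ ^ d)⁻¹ * Q)) with hK
  have hK0 : 0 ≤ K := by positivity
  have hind : IntegrableOn ((Set.Ioc 0 δ).indicator fun _ : ℝ => 2 * δ * M) (Set.Ioi 0) := by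
    refine ((integrable_indicator_iff measurableSet_Ioc).2 ?_).integrableOn
    exact integrableOn_const (by simp)
  have e1 : ∫ s in Set.Ioi (0:ℝ), (Set.Ioc 0 δ).indicator (fun _ : ℝ => 2 * δ * M) s =
      2 * δ ^ 2 * M := by
    rw [setIntegral_indicator measurableSet_Ioc]
    rw [Set.inter_eq_right.2 fun s hs => hs.1]
    simp [hδ.le]
    ring
  rw [← e1, ← integral_mul_const, ← integral_add hind ((w0_int hκ).mul_const K),
    ← Real.norm_eq_abs]
  refine norm_integral_le_of_norm_le (hind.add ((w0_int hκ).mul_const K))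
    ((ae_restrict_mem measurableSet_Ioi).mono fun s hs => ?_)
  have hs' : 0 < s := hs
  rw [norm_mul, Real.norm_eq_abs, Real.norm_eq_abs, abs_of_pos (by positivity)]
  have hexp : Real.exp (-κ * s ^ 2) ≤ 1 := Real.exp_le_one_iff.2 (by nlinarith [sq_nonneg s])
  by_cases hsδ : s ≤ δ
  · show _ ≤ (Set.Ioc 0 δ).indicator (fun _ : ℝ => 2 * δ * M) s + 2 * s * Real.exp (-κ * s ^ 2) * K
    rw [Set.indicator_of_mem (show s ∈ Set.Ioc 0 δ from ⟨hs', hsδ⟩)]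
    have h1 : 2 * s * Real.exp (-κ * s ^ 2) * |TT gam h s x| ≤ 2 * δ * 1 * M := by
      gcongr
      exact TT_gam_le hM s x
    have h2 : 0 ≤ 2 * s * Real.exp (-κ * s ^ 2) * K := by positivity
    linarith
  · show _ ≤ (Set.Ioc 0 δ).indicator (fun _ : ℝ => 2 * δ * M) s + 2 * s * Real.exp (-κ * s ^ 2) * K
    rw [Set.indicator_of_notMem (show s ∉ Set.Ioc 0 δ from fun h => hsδ h.2), zero_add]
    push Not at hsδ
    refine mul_le_mul_of_nonneg_left ((TT_L2 hi hs' x).trans ?_) (by positivity)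
    rw [hK]
    have : 0 ≤ ∫ x, h x ^ 2 := integral_nonneg fun x => sq_nonneg (h x)
    gcongr

lemma AA_integrable_x (hκ : 0 < κ) (hh : Continuous h) (hM : ∀ x, |h x| ≤ M)
    (hi : Integrable h) : Integrable (AA κ h) := by
  have hg : Continuous (gam : Euc d → ℝ) := continuous_gam
  set μ : Measure ℝ := volume.restrict (Set.Ioi (0:ℝ)) with hμ
  set wt : ℝ × Euc d → ℝ := fun p => (2 * p.1 * Real.exp (-κ * p.1 ^ 2)) * gam p.2 with hwt
  have hwtc : Continuous wt := by fun_prop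
  have hw : Integrable wt (μ.prod volume) :=
    Integrable.mul_prod (w0_int hκ) GD.gam.integrable
  have hF : Integrable (fun q : (ℝ × Euc d) × Euc d => wt q.1 * h (q.2 - q.1.1 • q.1.2))
      ((μ.prod volume).prod volume) := by
    refine (integrable_prod_iff (by fun_prop)).2 ⟨Eventually.of_forall fun p => ?_, ?_⟩
    · exact (hi.comp_sub_right (p.1 • p.2)).const_mul (wt p)
    · have : ∀ p : ℝ × Euc d, ∫ y, ‖wt p * h (y - p.1 • p.2)‖ = ‖wt p‖ * ∫ y, ‖h y‖ := by
        intro p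
        simp only [norm_mul]
        rw [integral_const_mul, integral_sub_right_eq_self (fun y => ‖h y‖)]
      simp only [this]
      exact hw.norm.mul_const _
  have h1 := hF.integral_prod_right
  refine h1.congr (Eventually.of_forall fun x => ?_)
  have i1 : Integrable (fun p : ℝ × Euc d => wt p * h (x - p.1 • p.2)) (μ.prod volume) := by
    refine (hw.norm.mul_const M).mono' (by fun_prop) (Eventually.of_forall fun p => ?_)
    rw [norm_mul]
    exact mul_le_mul_of_nonneg_left (hM _) (norm_nonneg _)
  simp only [AA]
  rw [integral_prod _ i1]
  refine integral_congr_ae (Eventually.of_forall fun s => ?_)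
  simp only [TT, hwt]
  rw [← integral_const_mul]
  refine integral_congr_ae (Eventually.of_forall fun z => ?_)
  simp only [smul_eq_mul]
  ring

end B

end Part10

section Part11

open MeasureTheory Metric Filter

lemma energy_bound {d : ℕ} {W f u : Euc d → ℝ} {M c : ℝ} (hc : 0 < c)
    (hW : Continuous W) (hf0 : ∀ x, 0 ≤ f x)
    (hf2 : Integrable fun x => f x ^ 2) (hu : ContDiff ℝ 2 u) (hu0 : ∀ x, 0 ≤ u x)
    (hM : ∀ x, |u x| ≤ M) (hui : Integrable u)
    (hsub : ∀ x, -laplacian u x + W x * u x ≤ f x)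
    (hform : ∀ φ : Euc d → ℝ, ContDiff ℝ 1 φ → HasCompactSupport φ →
      c * ∫ x, φ x ^ 2 ≤ ∫ x, (‖fderiv ℝ φ x‖ ^ 2 + W x * φ x ^ 2)) :
    Integrable (fun x => u x ^ 2) ∧ ∫ x, u x ^ 2 ≤ (∫ x, f x ^ 2) / c ^ 2 := by
  have cu := hu.continuous
  have cl := continuous_laplacian hu
  have i2 : Integrable fun x => u x ^ 2 := by
    refine (hui.norm.const_mul M).mono' (by fun_prop) (Eventually.of_forall fun x => ?_)
    rw [norm_pow, sq, Real.norm_eq_abs]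
    exact mul_le_mul_of_nonneg_right (hM x) (abs_nonneg _)
  refine ⟨i2, ?_⟩
  let b : ContDiffBump (0 : Euc d) := ⟨1, 2, by norm_num, by norm_num⟩
  have hb1 : ContDiff ℝ 1 b := b.contDiff
  have cb : Continuous (fderiv ℝ b) := hb1.continuous_fderiv (by norm_num)
  obtain ⟨B, hB⟩ := cb.bounded_above_of_compact_support (b.hasCompactSupport.fderiv (𝕜 := ℝ))
  have hB0 : 0 ≤ B := (norm_nonneg _).trans (hB 0)
  set a : ℕ → ℝ := fun n => ((n : ℝ) + 1)⁻¹ with ha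
  have ha0 : ∀ n, 0 < a n := fun n => by simp only [ha]; positivity
  set χ : ℕ → Euc d → ℝ := fun n x => b (a n • x) with hχ
  have hχ1 : ∀ n, ContDiff ℝ 1 (χ n) := fun n => hb1.comp (contDiff_const_smul (a n))
  have hχc : ∀ n, HasCompactSupport (χ n) := fun n =>
    b.hasCompactSupport.comp_smul (ha0 n).ne'
  have hχd : ∀ n x, ‖fderiv ℝ (χ n) x‖ ≤ a n * B := by
    intro n x
    have h1 := (hb1.differentiable (by norm_num) (a n • x)).hasFDerivAt
    have h2 : HasFDerivAt (fun x : Euc d => a n • x) (a n • ContinuousLinearMap.id ℝ (Euc d)) x :=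
      (hasFDerivAt_id x).const_smul (a n)
    have h3 : fderiv ℝ (χ n) x = _ := (h1.comp x h2).fderiv
    rw [h3, ContinuousLinearMap.comp_smul, norm_smul, Real.norm_eq_abs, abs_of_pos (ha0 n),
      ContinuousLinearMap.comp_id]
    exact mul_le_mul_of_nonneg_left (hB _) (ha0 n).le
  set I := ∫ x, u x ^ 2 with hI
  set F := ∫ x, f x ^ 2 with hF
  have hmain : ∀ n, c * ∫ x, (χ n x * u x) ^ 2 ≤
      ((a n * B) ^ 2 + c / 2) * I + 1 / (2 * c) * F := by
    intro n
    have hφ1 : ContDiff ℝ 1 (fun x => χ n x * u x) := (hχ1 n).mul (hu.of_le (by norm_num))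
    have hφc : HasCompactSupport (fun x => χ n x * u x) := (hχc n).mul_right
    refine (hform _ hφ1 hφc).trans ?_
    have cφ := hφ1.continuous
    have cφ' : Continuous (fderiv ℝ fun x => χ n x * u x) := hφ1.continuous_fderiv (by norm_num)
    have cχ := (hχ1 n).continuous
    have cχ' : Continuous (fderiv ℝ (χ n)) := (hχ1 n).continuous_fderiv (by norm_num)
    have j1 : Integrable fun x => ‖fderiv ℝ (fun x => χ n x * u x) x‖ ^ 2 :=
      integrable_of_tsupp (by fun_prop) hφc (fun x hx => by
        rw [fderiv_of_notMem_tsupport ℝ hx]; simp)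
    have j2 : Integrable fun x => W x * (χ n x * u x) ^ 2 :=
      integrable_of_tsupp (by fun_prop) (hχc n) (fun x hx => by
        rw [image_eq_zero_of_notMem_tsupport hx]; simp)
    have j3 : Integrable fun x => ‖fderiv ℝ (χ n) x‖ ^ 2 * u x ^ 2 -
        χ n x ^ 2 * u x * laplacian u x :=
      integrable_of_tsupp (by fun_prop) (hχc n) (fun x hx => by
        rw [image_eq_zero_of_notMem_tsupport hx, fderiv_of_notMem_tsupport ℝ hx]; simp)
    rw [integral_add j1 j2, energy_identity hu (hχ1 n) (hχc n), ← integral_add j3 j2,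
      hI, hF, ← integral_const_mul, ← integral_const_mul,
      ← integral_add (i2.const_mul _) (hf2.const_mul _)]
    refine integral_mono (j3.add j2) ((i2.const_mul _).add (hf2.const_mul _)) fun x => ?_
    have hb0 : 0 ≤ χ n x := b.nonneg
    have hb1 : χ n x ≤ 1 := b.le_one
    have hq : χ n x ^ 2 ≤ 1 := by nlinarith
    have e1 : ‖fderiv ℝ (χ n) x‖ ^ 2 * u x ^ 2 ≤ (a n * B) ^ 2 * u x ^ 2 := by
      gcongr; exact hχd n x
    have e2 : χ n x ^ 2 * u x * (-laplacian u x + W x * u x) ≤ χ n x ^ 2 * u x * f x :=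
      mul_le_mul_of_nonneg_left (hsub x) (mul_nonneg (sq_nonneg _) (hu0 x))
    have e3 : χ n x ^ 2 * (u x * f x) ≤ 1 * (u x * f x) :=
      mul_le_mul_of_nonneg_right hq (mul_nonneg (hu0 x) (hf0 x))
    have e4 : u x * f x ≤ c / 2 * u x ^ 2 + 1 / (2 * c) * f x ^ 2 := by
      have : 0 ≤ 1 / (2 * c) * (c * u x - f x) ^ 2 := by positivity
      have h5 : 1 / (2 * c) * (c * u x - f x) ^ 2 =
        c / 2 * u x ^ 2 + 1 / (2 * c) * f x ^ 2 - u x * f x := by field_simp; ring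
      linarith
    show ‖fderiv ℝ (χ n) x‖ ^ 2 * u x ^ 2 - χ n x ^ 2 * u x * laplacian u x +
      W x * (χ n x * u x) ^ 2 ≤ ((a n * B) ^ 2 + c / 2) * u x ^ 2 + 1 / (2 * c) * f x ^ 2
    have e5 : χ n x ^ 2 * u x * (-laplacian u x + W x * u x) =
      - (χ n x ^ 2 * u x * laplacian u x) + W x * (χ n x * u x) ^ 2 := by ring
    rw [e5] at e2
    linarith
  have hat : Tendsto a atTop (nhds 0) := by
    have := tendsto_one_div_add_atTop_nhds_zero_nat (𝕜 := ℝ)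
    simpa [ha] using this
  have hlim1 : Tendsto (fun n => c * ∫ x, (χ n x * u x) ^ 2) atTop (nhds (c * I)) := by
    refine Tendsto.const_mul c ?_
    refine tendsto_integral_of_dominated_convergence (fun x => u x ^ 2) (fun n => ?_) i2
      (fun n => Eventually.of_forall fun x => ?_) (Eventually.of_forall fun x => ?_)
    · have := (hχ1 n).continuous
      fun_prop
    · have hb0 : 0 ≤ χ n x := b.nonneg
      have hb1 : χ n x ≤ 1 := b.le_one
      rw [Real.norm_eq_abs, abs_of_nonneg (sq_nonneg _), mul_pow]
      exact mul_le_of_le_one_left (sq_nonneg _) (pow_le_one₀ hb0 hb1)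
    · refine tendsto_const_nhds.congr' ?_
      obtain ⟨N, hN⟩ := exists_nat_gt ‖x‖
      filter_upwards [eventually_ge_atTop N] with n hn
      have : χ n x = 1 := by
        refine b.one_of_mem_closedBall ?_
        rw [mem_closedBall_zero_iff, norm_smul, Real.norm_eq_abs, abs_of_pos (ha0 n)]
        simp only [ha]
        show ((n:ℝ) + 1)⁻¹ * ‖x‖ ≤ 1
        rw [inv_mul_le_iff₀ (by positivity)]
        have : (N : ℝ) ≤ n := by exact_mod_cast hn
        linarith
      rw [this, one_mul]
  have hlim2 : Tendsto (fun n => ((a n * B) ^ 2 + c / 2) * I + 1 / (2 * c) * F) atTop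
      (nhds (((0 * B) ^ 2 + c / 2) * I + 1 / (2 * c) * F)) :=
    ((((hat.mul_const B).pow 2).add_const _).mul_const I).add_const _
  have hfin := le_of_tendsto_of_tendsto' hlim1 hlim2 hmain
  rw [le_div_iff₀ (by positivity)]
  have h1 : c / 2 * I ≤ 1 / (2 * c) * F := by
    have : ((0 * B) ^ 2 + c / 2) * I = c / 2 * I := by ring
    rw [this] at hfin
    linarith
  have h2 := mul_le_mul_of_nonneg_left h1 (by positivity : 0 ≤ 2 * c)
  have h3 : 2 * c * (1 / (2 * c) * F) = F := by field_simp
  rw [h3] at h2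
  linarith

end Part11

section Part12

open MeasureTheory Metric Filter

/-- The monotone iteration. -/
noncomputable def UU {d : ℕ} (κ : ℝ) (P f : Euc d → ℝ) : ℕ → Euc d → ℝ
  | 0 => fun _ => 0
  | n + 1 => AA κ (fun x => P x * UU κ P f n x + f x)

lemma AA_BH {d : ℕ} {α κ : ℝ} (hκ : 0 < κ) (hα0 : 0 < α) (hα1 : α ≤ 1) {h : Euc d → ℝ}
    (hh : BH α h) : BH α (AA κ h) := by
  have hc := hh.continuous hα0
  obtain ⟨⟨M, hM⟩, -⟩ := hh
  have hM0 : 0 ≤ M := (abs_nonneg _).trans (hM 0)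
  refine BH.of_lip hα0 hα1 ?_ (AA_abs_le hκ hM) (AA_lip hκ hc hM)
  have h1 : 0 ≤ ∫ s in Set.Ioi (0:ℝ), 2 * Real.exp (-κ * s ^ 2) :=
    integral_nonneg fun s => by positivity
  have h2 : 0 ≤ ∫ z : Euc d, ‖gam1 z‖ := integral_nonneg fun s => norm_nonneg _
  positivity

lemma AA_nonneg {d : ℕ} {α κ : ℝ} (hκ : 0 < κ) (hα0 : 0 < α) {h : Euc d → ℝ}
    (hh : BH α h) (h0 : ∀ x, 0 ≤ h x) (x : Euc d) : 0 ≤ AA κ h x := by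
  have hc := hh.continuous hα0
  obtain ⟨⟨M, hM⟩, -⟩ := hh
  have := AA_mono (h := fun _ : Euc d => (0:ℝ)) (M := 0) hκ continuous_const (by simp) hc hM h0 x
  rwa [AA_zero] at this

lemma UU_inv {d : ℕ} {α κ : ℝ} (hκ : 0 < κ) (hα0 : 0 < α) (hα1 : α ≤ 1) {P f : Euc d → ℝ}
    (hP : BH α P) (hf : BH α f) (hP0 : ∀ x, 0 ≤ P x) (hf0 : ∀ x, 0 ≤ f x) (hfi : Integrable f)
    (n : ℕ) : BH α (UU κ P f n) ∧ (∀ x, 0 ≤ UU κ P f n x) ∧ Integrable (UU κ P f n) := by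
  induction n with
  | zero =>
    exact ⟨BH.const 0, fun x => le_rfl, by simpa [UU] using integrable_zero _ _ _⟩
  | succ n ih =>
    obtain ⟨h1, h2, h3⟩ := ih
    have hh : BH α (fun x => P x * UU κ P f n x + f x) := (hP.mul h1).add hf
    have hpos : ∀ x, 0 ≤ P x * UU κ P f n x + f x := fun x =>
      add_nonneg (mul_nonneg (hP0 x) (h2 x)) (hf0 x)
    refine ⟨AA_BH hκ hα0 hα1 hh, AA_nonneg hκ hα0 hh hpos, ?_⟩
    have hc := hh.continuous hα0
    obtain ⟨⟨M, hM⟩, -⟩ := hh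
    refine AA_integrable_x hκ hc hM (Integrable.add ?_ hfi)
    have cP := hP.continuous hα0
    have cU := h1.continuous hα0
    obtain ⟨⟨K, hK⟩, -⟩ := hP
    exact h3.bdd_mul (c := K) cP.aestronglyMeasurable (Eventually.of_forall hK)

lemma UU_mono {d : ℕ} {α κ : ℝ} (hκ : 0 < κ) (hα0 : 0 < α) (hα1 : α ≤ 1) {P f : Euc d → ℝ}
    (hP : BH α P) (hf : BH α f) (hP0 : ∀ x, 0 ≤ P x) (hf0 : ∀ x, 0 ≤ f x) (hfi : Integrable f)
    (n : ℕ) : ∀ x, UU κ P f n x ≤ UU κ P f (n + 1) x := by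
  have hB := fun n => (UU_inv hκ hα0 hα1 hP hf hP0 hf0 hfi n).1
  have hB' : ∀ n, BH α (fun x => P x * UU κ P f n x + f x) := fun n => (hP.mul (hB n)).add hf
  induction n with
  | zero => exact (UU_inv hκ hα0 hα1 hP hf hP0 hf0 hfi 1).2.1
  | succ n ih =>
    intro x
    obtain ⟨M, hM⟩ := (hB' n).1
    obtain ⟨M', hM'⟩ := (hB' (n+1)).1
    refine AA_mono hκ ((hB' n).continuous hα0) hM ((hB' (n+1)).continuous hα0) hM' (fun x => ?_) x
    have := mul_le_mul_of_nonneg_left (ih x) (hP0 x)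
    linarith

lemma exists_global_sol {d : ℕ} {α : ℝ} (hα0 : 0 < α) (hα1 : α ≤ 1) {W f : Euc d → ℝ}
    (hW : BH α W) {c : ℝ} (hc : 0 < c)
    (hform : ∀ φ : Euc d → ℝ, ContDiff ℝ 1 φ → HasCompactSupport φ →
      c * ∫ x, φ x ^ 2 ≤ ∫ x, (‖fderiv ℝ φ x‖ ^ 2 + W x * φ x ^ 2))
    (hf : BH α f) (hf0 : ∀ x, 0 ≤ f x) (hfc : HasCompactSupport f) {x₀ : Euc d}
    (hx₀ : 0 < f x₀) :
    ∃ u : Euc d → ℝ, ContDiff ℝ 2 u ∧ (∀ x, 0 < u x) ∧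
      ∀ x, -laplacian u x + W x * u x = f x := by
  obtain ⟨K, hK⟩ := hW.1
  have hK0 : 0 ≤ K := (abs_nonneg _).trans (hK 0)
  obtain ⟨Mf, hMf⟩ := hf.1
  have hMf0 : 0 ≤ Mf := (abs_nonneg _).trans (hMf 0)
  have cf := hf.continuous hα0
  have cW := hW.continuous hα0
  have hfi : Integrable f := cf.integrable_of_hasCompactSupport hfc
  have hf2 : Integrable fun x => f x ^ 2 :=
    integrable_of_tsupp (by fun_prop) hfc (fun x hx => by
        rw [image_eq_zero_of_notMem_tsupport hx]; simp)
  set κ := K + 1 with hκd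
  have hκ : 0 < κ := by positivity
  set P : Euc d → ℝ := fun x => κ + (-1) * W x with hPd
  have hP : BH α P := (BH.const κ).add ((BH.const (-1)).mul hW)
  have hP0 : ∀ x, 0 ≤ P x := fun x => by
    have := (abs_le.1 (hK x)).2
    simp only [hPd]; linarith
  set Pb := 2 * κ + 1 with hPb
  have hPb1 : 1 ≤ Pb := by linarith
  have hPle : ∀ x, P x ≤ Pb := fun x => by
    have := (abs_le.1 (hK x)).1
    simp only [hPd, hPb]; linarith
  set U := UU κ P f with hU
  have hinv := fun n => UU_inv hκ hα0 hα1 hP hf hP0 hf0 hfi n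
  have hmono := fun n => UU_mono hκ hα0 hα1 hP hf hP0 hf0 hfi n
  have hU0 : ∀ n x, 0 ≤ U n x := fun n => (hinv n).2.1
  set hn : ℕ → Euc d → ℝ := fun n x => P x * U n x + f x with hhn
  have hB : ∀ n, BH α (hn n) := fun n => (hP.mul (hinv n).1).add hf
  have hstep : ∀ n, U (n + 1) = AA κ (hn n) := fun n => rfl
  set F := ∫ x, f x ^ 2 with hF
  have hF0 : 0 ≤ F := integral_nonneg fun x => sq_nonneg _
  have hen : ∀ n, Integrable (fun x => U n x ^ 2) ∧ ∫ x, U n x ^ 2 ≤ F / c ^ 2 := by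
    intro n
    cases n with
    | zero =>
      have : U 0 = fun _ => 0 := rfl
      rw [this]
      refine ⟨by simp, ?_⟩
      simp
      positivity
    | succ n =>
      obtain ⟨⟨M, hM⟩, C, hC, hCC⟩ := hB n
      have hcn := (hB n).continuous hα0
      obtain ⟨M', hM'⟩ := (hinv (n+1)).1.1
      refine energy_bound hc cW hf0 hf2 (AA_contDiff hκ hα0 hα1 hcn hM hCC) (hU0 (n+1)) hM'
        (hinv (n+1)).2.2 (fun x => ?_) hform
      have e := AA_eq hκ hα0 hα1 hcn hM hCC x
      have h1 := mul_le_mul_of_nonneg_left (hmono n x) (hP0 x)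
      have h2 : UU κ P f (n + 1) x = AA κ (hn n) x := rfl
      rw [h2] at h1
      have h3 : hn n x = P x * UU κ P f n x + f x := rfl
      rw [h3] at e
      have h4 : P x * AA κ (hn n) x = κ * AA κ (hn n) x - W x * AA κ (hn n) x := by
        simp only [hPd]; ring
      rw [hstep n]
      linarith
  set Q := 2 * Pb ^ 2 * (F / c ^ 2) + 2 * F with hQ
  have hQ0 : 0 ≤ Q := by positivity
  have hL2 : ∀ n, Integrable (fun x => hn n x ^ 2) ∧ ∫ x, hn n x ^ 2 ≤ Q := by
    intro n
    have cn := (hB n).continuous hα0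
    have hpt : ∀ x, hn n x ^ 2 ≤ 2 * Pb ^ 2 * U n x ^ 2 + 2 * f x ^ 2 := by
      intro x
      have h1 : (P x * U n x) ^ 2 ≤ Pb ^ 2 * U n x ^ 2 := by
        rw [mul_pow]; gcongr
        exacts [hP0 x, hPle x]
      have h2 : hn n x ^ 2 ≤ 2 * (P x * U n x) ^ 2 + 2 * f x ^ 2 := by
        have : hn n x = P x * U n x + f x := rfl
        rw [this]; nlinarith [sq_nonneg (P x * U n x - f x)]
      linarith
    have ii : Integrable fun x => 2 * Pb ^ 2 * U n x ^ 2 + 2 * f x ^ 2 :=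
      ((hen n).1.const_mul _).add (hf2.const_mul _)
    have i1 : Integrable (fun x => hn n x ^ 2) :=
      ii.mono' (by fun_prop) (Eventually.of_forall fun x => by
        rw [Real.norm_eq_abs, abs_of_nonneg (sq_nonneg _)]; exact hpt x)
    refine ⟨i1, (integral_mono i1 ii hpt).trans ?_⟩
    rw [integral_add ((hen n).1.const_mul _) (hf2.const_mul _), integral_const_mul,
      integral_const_mul, hQ]
    have := mul_le_mul_of_nonneg_left (hen n).2 (by positivity : 0 ≤ 2 * Pb ^ 2)
    linarith
  have hPb0 : 0 < Pb := by linarith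
  set δ := 1 / (2 * Pb) with hδ
  have hδ0 : 0 < δ := by positivity
  have hδP : 2 * δ ^ 2 * Pb ≤ 1 / 2 := by
    have : 2 * δ ^ 2 * Pb = 1 / 2 * (1 / Pb) := by rw [hδ]; field_simp
    rw [this]
    have : 1 / Pb ≤ 1 := by rw [div_le_one hPb0]; exact hPb1
    linarith
  have hgc := gc_pos d
  set w0 := ∫ s in Set.Ioi (0:ℝ), 2 * s * Real.exp (-κ * s ^ 2) with hw0
  have hw00 : 0 ≤ w0 := setIntegral_nonneg measurableSet_Ioi fun s hs => by
    have : 0 < s := hs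
    positivity
  set K' := w0 * (1 / 2 + 1 / 2 * (gc d * ((δ ^ d)⁻¹ * Q))) with hK'
  have hK'0 : 0 ≤ K' := by positivity
  set S := 2 * (2 * δ ^ 2 * Mf + K') with hS
  have hS0 : 0 ≤ S := by positivity
  have hPU : ∀ n, (∀ x, |U n x| ≤ S) → ∀ x, |hn n x| ≤ Pb * S + Mf := by
    intro n h x
    refine (abs_add_le _ _).trans (add_le_add ?_ (hMf x))
    rw [abs_mul, abs_of_nonneg (hP0 x)]
    exact mul_le_mul (hPle x) (h x) (abs_nonneg _) hPb0.le
  have hsup : ∀ n x, |U n x| ≤ S := by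
    intro n
    induction n with
    | zero => intro x; have : U 0 x = 0 := rfl
              rw [this]; simpa using hS0
    | succ n ih =>
      intro x
      have h1 := AA_split hκ ((hB n).continuous hα0) (hPU n ih) (hL2 n).1 (hL2 n).2 hδ0 x
      rw [hstep]
      refine h1.trans ?_
      have h2 := mul_le_mul_of_nonneg_right hδP hS0
      have h3 : 2 * δ ^ 2 * (Pb * S + Mf) = 2 * δ ^ 2 * Pb * S + 2 * δ ^ 2 * Mf := by ring
      rw [h3]
      have h4 : S = 2 * (2 * δ ^ 2 * Mf + K') := rfl
      linarith
  set M := Pb * S + Mf with hMd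
  have hnM : ∀ n x, |hn n x| ≤ M := fun n => hPU n (hsup n)
  have hM0 : 0 ≤ M := by positivity
  set u : Euc d → ℝ := fun x => ⨆ n, U n x with hu
  have hlim : ∀ x, Tendsto (fun n => U n x) atTop (nhds (u x)) := fun x =>
    tendsto_atTop_ciSup (monotone_nat_of_le_succ fun n => hmono n x)
      ⟨S, by rintro _ ⟨n, rfl⟩; exact (le_abs_self _).trans (hsup n x)⟩
  have huS : ∀ x, |u x| ≤ S := fun x => le_of_tendsto' (hlim x).abs fun n => hsup n x
  have hu0 : ∀ x, 0 ≤ u x := fun x => ge_of_tendsto' (hlim x) fun n => hU0 n x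
  set L := (∫ s in Set.Ioi (0:ℝ), 2 * Real.exp (-κ * s ^ 2)) *
      (M * ∫ z : Euc d, ‖gam1 z‖) with hL
  have hL0 : 0 ≤ L := by
    have h1 : 0 ≤ ∫ s in Set.Ioi (0:ℝ), 2 * Real.exp (-κ * s ^ 2) :=
      integral_nonneg fun s => by positivity
    have h2 : 0 ≤ ∫ z : Euc d, ‖gam1 z‖ := integral_nonneg fun s => norm_nonneg _
    positivity
  have huL : ∀ x y, |u x - u y| ≤ L * ‖x - y‖ := fun x y => by
    refine le_of_tendsto (((hlim x).sub (hlim y)).abs) ?_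
    filter_upwards [eventually_ge_atTop 1] with n hn1
    obtain ⟨m, rfl⟩ := Nat.exists_eq_add_of_le' hn1
    exact AA_lip hκ ((hB m).continuous hα0) (hnM m) x y
  have hub : BH α u := BH.of_lip hα0 hα1 hL0 huS huL
  set h : Euc d → ℝ := fun x => P x * u x + f x with hh
  have hhB : BH α h := (hP.mul hub).add hf
  have hfix : u = AA κ h := by
    funext x
    have h1 : Tendsto (fun n => U (n + 1) x) atTop (nhds (AA κ h x)) :=
      AA_tendsto hκ (fun n => (hB n).continuous hα0) hnM
        (fun x => ((hlim x).const_mul (P x)).add_const (f x)) x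
    exact tendsto_nhds_unique ((tendsto_add_atTop_iff_nat 1).2 (hlim x)) h1
  have hch := hhB.continuous hα0
  obtain ⟨⟨Mh, hMh⟩, C, hC, hCC⟩ := hhB
  have hh0 : ∀ x, 0 ≤ h x := fun x => add_nonneg (mul_nonneg (hP0 x) (hu0 x)) (hf0 x)
  refine ⟨u, ?_, fun x => ?_, fun x => ?_⟩
  · rw [hfix]; exact AA_contDiff hκ hα0 hα1 hch hMh hCC
  · rw [hfix]
    exact AA_pos hκ hch hMh hh0 (x₀ := x₀) (add_pos_of_nonneg_of_pos (mul_nonneg (hP0 _) (hu0 _)) hx₀) x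
  · have e := AA_eq hκ hα0 hα1 hch hMh hCC x
    rw [← hfix] at e
    have h3 : h x = (κ + (-1) * W x) * u x + f x := rfl
    rw [h3] at e
    linarith

end Part12

open MeasureTheory Metric Filter

lemma lambda0_congr {d : ℕ} {Ω : Set (Euc d)} (hΩ : MeasurableSet Ω) {V V' : Euc d → ℝ}
    (h : ∀ x ∈ Ω, V' x = V x) : lambda0 Ω V' = lambda0 Ω V := by
  have key : ∀ u : Euc d → ℝ, ∫ x in Ω, (‖gradient u x‖ ^ 2 + V' x * (u x) ^ 2) =
      ∫ x in Ω, (‖gradient u x‖ ^ 2 + V x * (u x) ^ 2) := fun u =>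
    setIntegral_congr_fun hΩ fun x hx => by
      show ‖gradient u x‖ ^ 2 + V' x * (u x) ^ 2 = ‖gradient u x‖ ^ 2 + V x * (u x) ^ 2
      rw [h x hx]
  simp only [lambda0, key]

lemma bump_BH {d : ℕ} {α : ℝ} (hα0 : 0 < α) (hα1 : α ≤ 1) {z : Euc d} (b : ContDiffBump z) :
    BH α (fun x => b x) := by
  have hb1 : ContDiff ℝ 1 b := b.contDiff
  have cb : Continuous (fderiv ℝ b) := hb1.continuous_fderiv (by norm_num)
  obtain ⟨B, hB⟩ := cb.bounded_above_of_compact_support (b.hasCompactSupport.fderiv (𝕜 := ℝ))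
  have hB0 : 0 ≤ B := (norm_nonneg _).trans (hB 0)
  refine BH.of_lip hα0 hα1 (M := 1) hB0 (fun x => ?_) (fun x y => ?_)
  · rw [abs_of_nonneg b.nonneg]; exact b.le_one
  · exact convex_univ.norm_image_sub_le_of_norm_fderiv_le
      (fun z _ => hb1.differentiable (by norm_num) z) (fun z _ => hB z)
      (Set.mem_univ y) (Set.mem_univ x)

theorem statement3 (d : ℕ) (hd : 3 ≤ d) (y₀ : EuclideanSpace ℝ (Fin d)) (r : ℝ)
    (hr : 0 < r) (V : EuclideanSpace ℝ (Fin d) → ℝ)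
    (hV : ∃ C > (0:ℝ), ∃ α ∈ Set.Ioc (0:ℝ) 1, ∀ x ∈ closure (ball y₀ r),
      ∀ x' ∈ closure (ball y₀ r), |V x - V x'| ≤ C * ‖x - x'‖ ^ α)
    (lam : ℝ) :
    (∃ u : EuclideanSpace ℝ (Fin d) → ℝ,
      ContinuousOn u (closure (ball y₀ r)) ∧ ContDiffOn ℝ 2 u (ball y₀ r) ∧
      (∀ x ∈ ball y₀ r, -laplacian u x + V x * u x = lam * u x) ∧
      (∀ x ∈ closure (ball y₀ r), 0 < u x)) ↔
    lam < lambda0 (ball y₀ r) V := by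
  obtain ⟨C, hC, α, ⟨hα0, hα1⟩, hVH⟩ := hV
  rw [closure_ball y₀ hr.ne'] at hVH
  obtain ⟨V', hV', hVe⟩ := exists_ext hα0 hC y₀ hr hVH
  have hVb : ∀ x ∈ ball y₀ r, V' x = V x := fun x hx => hVe x (ball_subset_closedBall hx)
  rw [← lambda0_congr measurableSet_ball hVb]
  let i : Fin d := ⟨0, by omega⟩
  constructor
  · rintro ⟨u, hu0, hu2, hueq, hupos⟩
    exact forward_dir i y₀ hr (hV'.continuous hα0) lam hu0 hu2
      (fun x hx => by rw [hVb x hx]; exact hueq x hx) hupos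
  · intro hlam
    obtain ⟨W, hW, hWe, c, hc, hform⟩ := exists_global_form hα0 hα1 y₀ hr hV' hlam
    set z : Euc d := y₀ + (r + 2) • EuclideanSpace.single i (1:ℝ) with hz
    let b : ContDiffBump z := ⟨1 / 2, 1, by norm_num, by norm_num⟩
    have hbz : 0 < b z := by
      rw [b.one_of_mem_closedBall (by simp [b])]; norm_num
    obtain ⟨u, hu, hup, hue⟩ := exists_global_sol hα0 hα1 hW hc hform
      (bump_BH hα0 hα1 b) (fun x => b.nonneg) b.hasCompactSupport hbz
    refine ⟨u, hu.continuous.continuousOn, hu.contDiffOn, fun x hx => ?_, fun x _ => hup x⟩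
    have hbx : b x = 0 := by
      refine b.zero_of_le_dist ?_
      show (1:ℝ) ≤ dist x z
      have h1 : dist y₀ z = r + 2 := by
        rw [hz, dist_self_add_right, norm_smul, EuclideanSpace.norm_single]
        simp
        linarith
      have h2 := dist_triangle y₀ x z
      rw [mem_ball, dist_comm] at hx
      linarith
    have e := hue x
    rw [hbx, hWe x (ball_subset_closedBall hx), hVb x hx] at e
    linarith
end

section
/- Let d ≥ 3 and V ∈ L_{∞,loc}(ℝ^d). Let G ⊂ ℝ^d be an open bounded set with diam(G) = 2 that contains a ball B_ρ₀(0) (ρ₀ > 0) and is star-shaped with respect to every point of B_ρ₀(0), and set G_r(y) = {x ∈ ℝ^d : x/r ∈ G} + y. Let r₀ > 0 and let the sequence {G_{r₀}(y_k)}_{k≥1} form a ρ-covering of ℝ^d. Let θ₁ > 0, θ₂ > 0 with θ₁ + θ₂ = 1, and suppose that on each domain G_{r₀}(y_k) one has V = V₁^{(k)} + V₂^{(k)} with V₁^{(k)}, V₂^{(k)} ∈ L_∞(G_{r₀}(y_k)). If liminf_{k→∞} λ₀(G_{r₀}(y_k); θ_i^{-1}V_i^{(k)}) > −∞ for i = 1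 and i = 2, then the Schrödinger operator H = −Δ + V is bounded below: there exists C ∈ ℝ such that ∫_{ℝ^d}(|∇u|² + V|u|²) dx ≥ −C ∫_{ℝ^d}|u|² dx for all u ∈ C₀^∞(ℝ^d). -/
open MeasureTheory Metric Filter

/-- `G_r(y) = {x : x/r ∈ G} + y`. -/
def Gr {d : ℕ} (G : Set (EuclideanSpace ℝ (Fin d))) (r : ℝ)
    (y : EuclideanSpace ℝ (Fin d)) : Set (EuclideanSpace ℝ (Fin d)) :=
  {x | r⁻¹ • (x - y) ∈ G}

lemma aux_grad_cont {d : ℕ} {u : EuclideanSpace ℝ (Fin d) → ℝ} (hu : ContDiff ℝ (⊤ : ℕ∞) u) :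
    Continuous (gradient u) := by
  have h := hu.continuous_fderiv (by simp)
  exact (InnerProductSpace.toDual ℝ (EuclideanSpace ℝ (Fin d))).symm.continuous.comp h

lemma aux_grad_zero {d : ℕ} {u : EuclideanSpace ℝ (Fin d) → ℝ} {x : EuclideanSpace ℝ (Fin d)}
    (hx : x ∉ tsupport u) : gradient u x = 0 := by
  have h : fderiv ℝ u x = 0 := by
    by_contra h
    exact hx (support_fderiv_subset ℝ h)
  simp [gradient, h]

lemma aux_grad_supp {d : ℕ} {u : EuclideanSpace ℝ (Fin d) → ℝ} (hc : HasCompactSupport u) :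
    HasCompactSupport (gradient u) :=
  HasCompactSupport.intro hc fun _ hx => aux_grad_zero hx

lemma aux_sq_int {d : ℕ} {u : EuclideanSpace ℝ (Fin d) → ℝ} (hu : Continuous u)
    (hc : HasCompactSupport u) : Integrable (fun x => (u x) ^ 2) := by
  refine (hu.pow 2).integrable_of_hasCompactSupport ?_
  exact HasCompactSupport.intro hc fun x hx => by simp [image_eq_zero_of_notMem_tsupport hx]

lemma aux_gsq_int {d : ℕ} {u : EuclideanSpace ℝ (Fin d) → ℝ} (hu : ContDiff ℝ (⊤ : ℕ∞) u)
    (hc : HasCompactSupport u) : Integrable (fun x => ‖gradient u x‖ ^ 2) := by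
  refine ((aux_grad_cont hu).norm.pow 2).integrable_of_hasCompactSupport ?_
  exact HasCompactSupport.intro hc fun x hx => by simp [aux_grad_zero hx]

lemma aux_pot_int {d : ℕ} {Ω : Set (EuclideanSpace ℝ (Fin d))} (hΩ : MeasurableSet Ω)
    {W u : EuclideanSpace ℝ (Fin d) → ℝ} (hW : Measurable W) {M : ℝ}
    (hM : ∀ x ∈ Ω, |W x| ≤ M) (hu : Continuous u)
    (hc : HasCompactSupport u) : IntegrableOn (fun x => W x * (u x) ^ 2) Ω :=
  Integrable.bdd_mul (c := M) (aux_sq_int hu hc).integrableOn hW.aestronglyMeasurable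
    (ae_restrict_of_forall_mem hΩ hM)

lemma aux_crude {d : ℕ} {Ω : Set (EuclideanSpace ℝ (Fin d))} (hΩ : MeasurableSet Ω)
    {W u : EuclideanSpace ℝ (Fin d) → ℝ} (hW : Measurable W) {M : ℝ}
    (hM : ∀ x ∈ Ω, |W x| ≤ M) (hu : ContDiff ℝ (⊤ : ℕ∞) u) (hc : HasCompactSupport u) :
    -M * (∫ x in Ω, (u x) ^ 2) ≤ ∫ x in Ω, (‖gradient u x‖ ^ 2 + W x * (u x) ^ 2) := by
  rw [← integral_const_mul]
  refine setIntegral_mono_on ((aux_sq_int hu.continuous hc).integrableOn.const_mul _)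
    ((aux_gsq_int hu hc).integrableOn.add (aux_pot_int hΩ hW hM hu.continuous hc)) hΩ ?_
  intro x hx
  have h1 := neg_le_of_abs_le (hM x hx)
  nlinarith [sq_nonneg (u x), sq_nonneg ‖gradient u x‖,
    mul_le_mul_of_nonneg_right h1 (sq_nonneg (u x))]

lemma aux_sq_set {d : ℕ} {Ω : Set (EuclideanSpace ℝ (Fin d))}
    {u : EuclideanSpace ℝ (Fin d) → ℝ} (hs : tsupport u ⊆ Ω) :
    ∫ x in Ω, (u x) ^ 2 = ∫ x, (u x) ^ 2 :=
  setIntegral_eq_integral_of_forall_compl_eq_zero fun x hx => by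
    simp [image_eq_zero_of_notMem_tsupport (fun h => hx (hs h))]

lemma aux_sq_pos {d : ℕ} {u : EuclideanSpace ℝ (Fin d) → ℝ} (hu : Continuous u)
    (hc : HasCompactSupport u) (h0 : u ≠ 0) : 0 < ∫ x, (u x) ^ 2 := by
  obtain ⟨x, hx⟩ := Function.ne_iff.1 h0
  exact integral_pos_of_integrable_nonneg_nonzero
    (x := x) (hu.pow 2) (aux_sq_int hu hc) (fun x => sq_nonneg _) (pow_ne_zero 2 hx)

lemma aux_lambda {d : ℕ} {Ω : Set (EuclideanSpace ℝ (Fin d))} (hΩ : MeasurableSet Ω)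
    {W v : EuclideanSpace ℝ (Fin d) → ℝ} (hW : Measurable W) {M c : ℝ}
    (hM : ∀ x ∈ Ω, |W x| ≤ M) (hcl : c ≤ lambda0 Ω W)
    (hv : ContDiff ℝ (⊤ : ℕ∞) v) (hc : HasCompactSupport v) (hs : tsupport v ⊆ Ω) :
    c * (∫ x in Ω, (v x) ^ 2) ≤ ∫ x in Ω, (‖gradient v x‖ ^ 2 + W x * (v x) ^ 2) := by
  by_cases h0 : v = 0
  · subst h0
    simp [gradient]
  have hpos : 0 < ∫ x in Ω, (v x) ^ 2 := by
    rw [aux_sq_set hs]; exact aux_sq_pos hv.continuous hc h0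
  rw [← le_div_iff₀ hpos]
  refine hcl.trans (csInf_le ⟨-M, ?_⟩ ⟨v, hv, hc, hs, h0, rfl⟩)
  rintro q ⟨u, hu, huc, hus, hu0, rfl⟩
  have hpos : 0 < ∫ x in Ω, (u x) ^ 2 := by
    rw [aux_sq_set hus]; exact aux_sq_pos hu.continuous huc hu0
  rw [le_div_iff₀ hpos]
  exact aux_crude hΩ hW hM hu huc

lemma aux_full {d : ℕ} {Ω : Set (EuclideanSpace ℝ (Fin d))}
    {W v : EuclideanSpace ℝ (Fin d) → ℝ} (hs : tsupport v ⊆ Ω) :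
    ∫ x in Ω, (‖gradient v x‖ ^ 2 + W x * (v x) ^ 2) =
      ∫ x, (‖gradient v x‖ ^ 2 + W x * (v x) ^ 2) :=
  setIntegral_eq_integral_of_forall_compl_eq_zero fun x hx => by
    simp [image_eq_zero_of_notMem_tsupport (fun h => hx (hs h)),
      aux_grad_zero (fun h => hx (hs h))]

lemma aux_split {d : ℕ} {Ω : Set (EuclideanSpace ℝ (Fin d))} (hΩ : MeasurableSet Ω)
    {V V₁ V₂ v : EuclideanSpace ℝ (Fin d) → ℝ} (h1 : Measurable V₁) (h2 : Measurable V₂)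
    {M₁ M₂ c₁ c₂ θ₁ θ₂ : ℝ} (hM₁ : ∀ x ∈ Ω, |V₁ x| ≤ M₁) (hM₂ : ∀ x ∈ Ω, |V₂ x| ≤ M₂)
    (hθ₁ : 0 < θ₁) (hθ₂ : 0 < θ₂) (hθ : θ₁ + θ₂ = 1)
    (hV : ∀ x ∈ Ω, V x = V₁ x + V₂ x)
    (hl₁ : c₁ ≤ lambda0 Ω (fun x => θ₁⁻¹ * V₁ x)) (hl₂ : c₂ ≤ lambda0 Ω (fun x => θ₂⁻¹ * V₂ x))
    (hv : ContDiff ℝ (⊤ : ℕ∞) v) (hc : HasCompactSupport v) (hs : tsupport v ⊆ Ω) :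
    (θ₁ * c₁ + θ₂ * c₂) * (∫ x in Ω, (v x) ^ 2)
      ≤ ∫ x in Ω, (‖gradient v x‖ ^ 2 + V x * (v x) ^ 2) := by
  have b₁ : ∀ x ∈ Ω, |θ₁⁻¹ * V₁ x| ≤ θ₁⁻¹ * M₁ := fun x hx => by
    rw [abs_mul, abs_of_pos (inv_pos.2 hθ₁)]
    exact mul_le_mul_of_nonneg_left (hM₁ x hx) (inv_pos.2 hθ₁).le
  have b₂ : ∀ x ∈ Ω, |θ₂⁻¹ * V₂ x| ≤ θ₂⁻¹ * M₂ := fun x hx => by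
    rw [abs_mul, abs_of_pos (inv_pos.2 hθ₂)]
    exact mul_le_mul_of_nonneg_left (hM₂ x hx) (inv_pos.2 hθ₂).le
  have m₁ : Measurable fun x => θ₁⁻¹ * V₁ x := h1.const_mul _
  have m₂ : Measurable fun x => θ₂⁻¹ * V₂ x := h2.const_mul _
  have e₁ := mul_le_mul_of_nonneg_left (aux_lambda hΩ m₁ b₁ hl₁ hv hc hs) hθ₁.le
  have e₂ := mul_le_mul_of_nonneg_left (aux_lambda hΩ m₂ b₂ hl₂ hv hc hs) hθ₂.le
  have key : ∫ x in Ω, (‖gradient v x‖ ^ 2 + V x * (v x) ^ 2)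
      = θ₁ * (∫ x in Ω, (‖gradient v x‖ ^ 2 + θ₁⁻¹ * V₁ x * (v x) ^ 2))
      + θ₂ * (∫ x in Ω, (‖gradient v x‖ ^ 2 + θ₂⁻¹ * V₂ x * (v x) ^ 2)) := by
    rw [← integral_const_mul, ← integral_const_mul, ← integral_add]
    · refine setIntegral_congr_fun hΩ fun x hx => ?_
      rw [hV x hx]
      have : θ₂ = 1 - θ₁ := by linarith
      field_simp
      rw [this]
      ring
    · exact ((aux_gsq_int hv hc).integrableOn.add
        (aux_pot_int hΩ m₁ b₁ hv.continuous hc)).const_mul _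
    · exact ((aux_gsq_int hv hc).integrableOn.add
        (aux_pot_int hΩ m₂ b₂ hv.continuous hc)).const_mul _
  rw [key]
  linarith

/-- Continuous IMS localization formula. -/
lemma aux_ims {d : ℕ} {V : EuclideanSpace ℝ (Fin d) → ℝ} (hVmeas : Measurable V)
    (hVloc : ∀ K : Set (EuclideanSpace ℝ (Fin d)), IsCompact K →
      ∃ M : ℝ, ∀ x ∈ K, |V x| ≤ M) {ρ : ℝ} (hρ : 0 < ρ) {C : ℝ}
    (hloc : ∀ (z : EuclideanSpace ℝ (Fin d)) (v : EuclideanSpace ℝ (Fin d) → ℝ),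
      ContDiff ℝ (⊤ : ℕ∞) v → HasCompactSupport v → tsupport v ⊆ ball z ρ →
      -C * ∫ x, (v x) ^ 2 ≤ ∫ x, (‖gradient v x‖ ^ 2 + V x * (v x) ^ 2)) :
    ∃ C' : ℝ, ∀ u : EuclideanSpace ℝ (Fin d) → ℝ, ContDiff ℝ (⊤ : ℕ∞) u → HasCompactSupport u →
      -C' * ∫ x, (u x) ^ 2 ≤ ∫ x, (‖gradient u x‖ ^ 2 + V x * (u x) ^ 2) := by
  let φ : ContDiffBump (0 : EuclideanSpace ℝ (Fin d)) :=
    ⟨ρ / 4, ρ / 2, by positivity, by linarith⟩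
  have hφ : ContDiff ℝ (⊤ : ℕ∞) φ := φ.contDiff
  have hφc : HasCompactSupport φ := φ.hasCompactSupport
  have hφ0 : (φ : EuclideanSpace ℝ (Fin d) → ℝ) ≠ 0 := by
    intro h
    have h1 : φ 0 = 1 := φ.one_of_mem_closedBall (by simp [φ.rIn_pos.le])
    rw [h] at h1
    simp at h1
  set P := ∫ x, (φ x) ^ 2 with hP
  set K := ∫ x, ‖gradient φ x‖ ^ 2 with hK
  have hPpos : 0 < P := aux_sq_pos hφ.continuous hφc hφ0
  refine ⟨C + K / P, fun u hu hc => ?_⟩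
  obtain ⟨M, hM⟩ := hVloc _ hc
  have iV : Integrable fun x => V x * (u x) ^ 2 := by
    have h := aux_pot_int (isClosed_tsupport u).measurableSet hVmeas hM hu.continuous hc
    rw [integrableOn_iff_integrable_of_support_subset] at h
    · exact h
    · intro x hx
      by_contra h'
      simp [image_eq_zero_of_notMem_tsupport h'] at hx
  have iA : Integrable fun x => ‖gradient u x‖ ^ 2 + V x * (u x) ^ 2 := (aux_gsq_int hu hc).add iV
  have iu := aux_sq_int hu.continuous hc
  have iφ := aux_sq_int hφ.continuous hφc
  have igφ := aux_gsq_int hφ hφc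
  have cross : ∀ w : EuclideanSpace ℝ (Fin d) → ℝ, ContDiff ℝ (⊤ : ℕ∞) w → HasCompactSupport w →
      Integrable fun x => w x • gradient w x := fun w hw hwc =>
    (hw.continuous.smul (aux_grad_cont hw)).integrable_of_hasCompactSupport
      (HasCompactSupport.intro hwc fun x hx => by simp [aux_grad_zero hx])
  have iuu := cross u hu hc
  have iφφ := cross φ hφ hφc
  have hodd : ∫ x, φ x • gradient φ x = 0 := by
    have hg : ∀ x, gradient φ (-x) = - gradient φ x := by
      intro x
      have h : HasGradientAt φ (gradient φ (-x)) (-x) :=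
        (hφ.differentiable (by simp) _).hasGradientAt
      have h2 : HasGradientAt φ (-gradient φ (-x)) x := by
        rw [hasGradientAt_iff_hasFDerivAt] at h ⊢
        have h3 := h.comp x (hasFDerivAt_id x).neg
        have h4 : (φ ∘ Neg.neg : EuclideanSpace ℝ (Fin d) → ℝ) = φ := by
          funext t; simp [φ.neg]
        have h5 : HasFDerivAt (φ ∘ Neg.neg : EuclideanSpace ℝ (Fin d) → ℝ) _ x := h3
        rw [h4] at h5
        refine h5.congr_fderiv ?_
        ext t; simp
      rw [h2.gradient, neg_neg]
    have h := integral_neg_eq_self (fun x => φ x • gradient φ x) volume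
    simp only [hg, φ.neg, smul_neg, integral_neg] at h
    have h6 : (2 : ℝ) • (∫ x, φ x • gradient φ x) = 0 := by
      rw [two_smul]
      nth_rewrite 1 [← h]
      simp
    simpa using h6
  let L := ContinuousLinearMap.mul ℝ ℝ
  let B := innerSL ℝ (E := EuclideanSpace ℝ (Fin d))
  have key : ∀ z, (∫ t, L ((u t) ^ 2) ((φ (z - t)) ^ 2)) = ∫ t, (φ (z - t) * u t) ^ 2 := by
    intro z
    refine integral_congr_ae (.of_forall fun t => ?_)
    simp [L]; ring
  have kv : ∀ z t, ‖gradient (fun x => φ (z - x) * u x) t‖ ^ 2 + V t * (φ (z - t) * u t) ^ 2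
      = L (‖gradient u t‖ ^ 2 + V t * (u t) ^ 2) ((φ (z - t)) ^ 2)
        - 2 * B (u t • gradient u t) (φ (z - t) • gradient φ (z - t))
        + L ((u t) ^ 2) (‖gradient φ (z - t)‖ ^ 2) := by
    intro z t
    have h : HasGradientAt φ (gradient φ (z - t)) (z - t) :=
        (hφ.differentiable (by simp) _).hasGradientAt
    have hu' : HasGradientAt u (gradient u t) t := (hu.differentiable (by simp) _).hasGradientAt
    have h2 : HasGradientAt (fun x => φ (z - x) * u x)
        (φ (z - t) • gradient u t - u t • gradient φ (z - t)) t := by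
      rw [hasGradientAt_iff_hasFDerivAt] at h hu' ⊢
      have h3 := (h.comp t ((hasFDerivAt_id t).const_sub z)).mul hu'
      have h5 : HasFDerivAt (fun x => φ (z - x) * u x) _ t := h3
      refine h5.congr_fderiv ?_
      ext s; simp; ring
    rw [h2.gradient, norm_sub_sq_real, norm_smul, norm_smul, inner_smul_left, inner_smul_right]
    simp only [L, B, ContinuousLinearMap.mul_apply', innerSL_apply_apply, inner_smul_left,
      inner_smul_right, mul_pow, Real.norm_eq_abs, sq_abs]
    simp
    ring
  have hz : ∀ z, -C * (∫ t, L ((u t) ^ 2) ((φ (z - t)) ^ 2)) ≤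
      ∫ t, (L (‖gradient u t‖ ^ 2 + V t * (u t) ^ 2) ((φ (z - t)) ^ 2)
        - 2 * B (u t • gradient u t) (φ (z - t) • gradient φ (z - t))
        + L ((u t) ^ 2) (‖gradient φ (z - t)‖ ^ 2)) := by
    intro z
    rw [key]
    simp_rw [← kv]
    refine hloc z (fun x => φ (z - x) * u x) ?_ ?_ ?_
    · exact (hφ.comp (contDiff_const.sub contDiff_id)).mul hu
    · exact hc.mul_left
    · have : tsupport (fun x => φ (z - x) * u x) ⊆ closedBall z (ρ / 2) := by
        refine closure_minimal (fun x hx => ?_) isClosed_closedBall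
        have h1 : φ (z - x) ≠ 0 := left_ne_zero_of_mul hx
        have h2 : z - x ∈ Function.support φ := h1
        rw [φ.support_eq] at h2
        rw [mem_closedBall, dist_comm, dist_eq_norm]
        exact (mem_ball_zero_iff.1 h2).le
      exact this.trans (closedBall_subset_ball (by linarith))
  have J1 := iA.ae_convolution_exists L iφ
  have J2 := iuu.ae_convolution_exists B iφφ
  have J3 := iu.ae_convolution_exists L igφ
  have I0 := iu.integrable_convolution L iφ
  have I1 := iA.integrable_convolution L iφ
  have I2 := iuu.integrable_convolution B iφφ
  have I3 := iu.integrable_convolution L igφ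
  have E0 := integral_convolution L iu iφ
  have E1 := integral_convolution L iA iφ
  have E2 := integral_convolution B iuu iφφ
  have E3 := integral_convolution L iu igφ
  have main := integral_mono_ae (I0.const_mul (-C)) ((I1.sub (I2.const_mul 2)).add I3) (by
    filter_upwards [J1, J2, J3] with z j1 j2 j3
    have h := hz z
    have j12 : Integrable fun t => L (‖gradient u t‖ ^ 2 + V t * (u t) ^ 2) ((φ (z - t)) ^ 2)
        - 2 * B (u t • gradient u t) (φ (z - t) • gradient φ (z - t)) :=
      j1.integrable.sub (j2.integrable.const_mul 2)
    rw [integral_add j12 j3.integrable,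
      integral_sub j1.integrable (j2.integrable.const_mul 2), integral_const_mul] at h
    exact h)
  simp only [Pi.add_apply, Pi.sub_apply] at main
  rw [integral_const_mul, integral_add (by exact I1.sub (I2.const_mul 2)) I3,
    integral_sub I1 (I2.const_mul 2), integral_const_mul, E0, E1, E2, E3, hodd] at main
  simp only [L, ContinuousLinearMap.mul_apply', map_zero, mul_zero, sub_zero] at main
  rw [← hP, ← hK] at main
  have : -(C + K / P) * ∫ x, (u x) ^ 2 = (-C * ((∫ x, (u x) ^ 2) * P) - (∫ x, (u x) ^ 2) * K) / P := by
    field_simp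
    ring
  rw [this, div_le_iff₀ hPpos]
  linarith

theorem statement5 (d : ℕ) (hd : 3 ≤ d) (V : EuclideanSpace ℝ (Fin d) → ℝ)
    (hVmeas : Measurable V)
    (hVloc : ∀ K : Set (EuclideanSpace ℝ (Fin d)), IsCompact K →
      ∃ M : ℝ, ∀ x ∈ K, |V x| ≤ M)
    (G : Set (EuclideanSpace ℝ (Fin d))) (ρ₀ : ℝ) (hρ₀ : 0 < ρ₀)
    (hGopen : IsOpen G) (hGbdd : Bornology.IsBounded G) (hGdiam : Metric.diam G = 2)
    (hGball : ball (0 : EuclideanSpace ℝ (Fin d)) ρ₀ ⊆ G)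
    (hGstar : ∀ c ∈ ball (0 : EuclideanSpace ℝ (Fin d)) ρ₀, StarConvex ℝ c G)
    (r₀ : ℝ) (hr₀ : 0 < r₀) (y : ℕ → EuclideanSpace ℝ (Fin d)) (ρ : ℝ) (hρ : 0 < ρ)
    (hcov₁ : Tendsto (fun k => ‖y k‖) atTop atTop)
    (hcov₂ : ∀ z : EuclideanSpace ℝ (Fin d), ∃ j : ℕ, ball z ρ ⊆ Gr G r₀ (y j))
    (θ₁ θ₂ : ℝ) (hθ₁ : 0 < θ₁) (hθ₂ : 0 < θ₂) (hθ : θ₁ + θ₂ = 1)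
    (V₁ V₂ : ℕ → EuclideanSpace ℝ (Fin d) → ℝ)
    (hsplit : ∀ k : ℕ, ∀ x ∈ Gr G r₀ (y k), V x = V₁ k x + V₂ k x)
    (hm₁ : ∀ k, Measurable (V₁ k)) (hm₂ : ∀ k, Measurable (V₂ k))
    (hb₁ : ∀ k, ∃ M : ℝ, ∀ x ∈ Gr G r₀ (y k), |V₁ k x| ≤ M)
    (hb₂ : ∀ k, ∃ M : ℝ, ∀ x ∈ Gr G r₀ (y k), |V₂ k x| ≤ M)
    (hlb₁ : ∃ c : ℝ, ∃ N : ℕ, ∀ k ≥ N,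
      c ≤ lambda0 (Gr G r₀ (y k)) (fun x => θ₁⁻¹ * V₁ k x))
    (hlb₂ : ∃ c : ℝ, ∃ N : ℕ, ∀ k ≥ N,
      c ≤ lambda0 (Gr G r₀ (y k)) (fun x => θ₂⁻¹ * V₂ k x)) :
    ∃ C : ℝ, ∀ u : EuclideanSpace ℝ (Fin d) → ℝ, ContDiff ℝ (⊤ : ℕ∞) u → HasCompactSupport u →
      -C * ∫ x, (u x) ^ 2 ≤ ∫ x, (‖gradient u x‖ ^ 2 + V x * (u x) ^ 2) := by
  obtain ⟨c₁, N₁, hc₁⟩ := hlb₁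
  obtain ⟨c₂, N₂, hc₂⟩ := hlb₂
  choose M₁ hM₁ using hb₁
  choose M₂ hM₂ using hb₂
  have hopen : ∀ k, MeasurableSet (Gr G r₀ (y k)) := fun k =>
    (hGopen.preimage (by fun_prop : Continuous fun x => r₀⁻¹ • (x - y k))).measurableSet
  set S : ℝ := ∑ j ∈ Finset.range (max N₁ N₂), |M₁ j + M₂ j| with hS
  have hS0 : 0 ≤ S := Finset.sum_nonneg fun _ _ => abs_nonneg _
  refine aux_ims hVmeas hVloc hρ (C := |θ₁ * c₁ + θ₂ * c₂| + S) ?_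
  intro z v hv hvc hvs
  obtain ⟨j, hj⟩ := hcov₂ z
  have hs := hvs.trans hj
  rw [← aux_full hs, ← aux_sq_set hs]
  have hI : 0 ≤ ∫ x in Gr G r₀ (y j), (v x) ^ 2 := integral_nonneg fun x => sq_nonneg _
  by_cases h : max N₁ N₂ ≤ j
  · refine le_trans ?_ (aux_split (hopen j) (hm₁ j) (hm₂ j) (hM₁ j) (hM₂ j) hθ₁ hθ₂ hθ (hsplit j)
      (hc₁ j (le_trans (le_max_left _ _) h)) (hc₂ j (le_trans (le_max_right _ _) h)) hv hvc hs)
    refine mul_le_mul_of_nonneg_right ?_ hI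
    linarith [neg_abs_le (θ₁ * c₁ + θ₂ * c₂)]
  · refine le_trans ?_ (aux_crude (hopen j) hVmeas (M := M₁ j + M₂ j) ?_ hv hvc)
    · refine mul_le_mul_of_nonneg_right ?_ hI
      have h1 : |M₁ j + M₂ j| ≤ S := Finset.single_le_sum (f := fun j => |M₁ j + M₂ j|)
        (fun _ _ => abs_nonneg _) (Finset.mem_range.2 (not_le.1 h))
      linarith [le_abs_self (M₁ j + M₂ j), abs_nonneg (θ₁ * c₁ + θ₂ * c₂)]
    · intro x hx
      rw [hsplit j x hx]
      exact (abs_add_le _ _).trans (add_le_add (hM₁ j x hx) (hM₂ j x hx))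
end
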